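/- arXiv:2008.03361 — 8 statements merged into one kernel-verified Lean document; each statement's English description precedes it below -/
import Mathlib

section
/- Let A be a unital C*-algebra and v ∈ A. Set a = v v* and b = v* v, and assume ‖a‖ ≤ 1 and a·b = 0. Let g : [0,1] → ℝ be the continuous function with g(t) = sin(πt/2)/√t for t ∈ (0,1] and g(0) = 0, and define w = cos((π/2)(v v* + v* v)) + g(v v*)·v − g(v* v)·v*, where cos((π/2)·) and g are applied via the continuous functional calculus. Then w is a unitary element of A which lies in the closed unital *-subalgebra of A generated by v, and moreover: (i) for every c ∈ A with a c = c a = c one has b(w* c w) = (w* c w) b = w* c w; (ii) for every c ∈ A with b c = c b = c one has a(w c w*) = (w c w*) a = w c w*. -/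
theorem SemiconjBy.cfc_real {A : Type*} [CStarAlgebra A] {x a b : A} (h : SemiconjBy x b a)
    (ha : IsSelfAdjoint a) (hb : IsSelfAdjoint b) {f : ℝ → ℝ} (hf : Continuous f) :
    SemiconjBy x (cfc f b) (cfc f a) := by
  let s : Set ℝ := spectrum ℝ a ∪ spectrum ℝ b
  have hsa : spectrum ℝ a ⊆ s := Set.subset_union_left
  have hsb : spectrum ℝ b ⊆ s := Set.subset_union_right
  have hs : CompactSpace s := isCompact_iff_compactSpace.mp
    ((spectrum.isCompact (𝕜 := ℝ) a).union (spectrum.isCompact (𝕜 := ℝ) b))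
  have key : ∀ F : C(s, ℝ),
      SemiconjBy x (cfcHomSuperset hb hsb F) (cfcHomSuperset ha hsa F) := by
    intro F
    induction F using ContinuousMap.induction_on_of_compact with
    | const r =>
      have hr : ContinuousMap.const s r = algebraMap ℝ C(s, ℝ) r := rfl
      rw [hr, AlgHomClass.commutes, AlgHomClass.commutes]
      exact Algebra.commute_algebraMap_right r x
    | id => rwa [cfcHomSuperset_id, cfcHomSuperset_id]
    | star_id =>
      rwa [map_star, map_star, cfcHomSuperset_id, cfcHomSuperset_id, ha.star_eq, hb.star_eq]
    | add f g hf hg => rw [map_add, map_add]; exact hf.add_right hg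
    | mul f g hf hg => rw [map_mul, map_mul]; exact hf.mul_right hg
    | frequently f hf =>
      have hca := cfcHomSuperset_continuous ha hsa
      have hcb := cfcHomSuperset_continuous hb hsb
      exact hf.mem_of_closed (s := {F | SemiconjBy x (cfcHomSuperset hb hsb F)
        (cfcHomSuperset ha hsa F)}) (isClosed_eq (by fun_prop) (by fun_prop))
  have := key ⟨_, hf.continuousOn.domRestrict⟩
  rw [cfcHomSuperset_apply, cfcHomSuperset_apply] at this
  rw [cfc_apply f a ha hf.continuousOn, cfc_apply f b hb hf.continuousOn]
  exact this

/-- If `a * c = c`, then `cfc f a` acts on `c` as the scalar `f 1`. -/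
theorem cfc_real_mul_eq_smul_of_mul_eq_self {A : Type*} [CStarAlgebra A] {a c : A}
    (ha : IsSelfAdjoint a) (hc : a * c = c) {f : ℝ → ℝ} (hf : Continuous f) :
    cfc f a * c = f 1 • c := by
  have h : SemiconjBy c 1 a := by rw [SemiconjBy, mul_one, hc]
  have := (h.cfc_real ha (.one A) hf).eq
  rw [cfc_apply_one, ← Algebra.commutes, ← Algebra.smul_def] at this
  exact this.symm

theorem Real.continuous_sin_pi_div_two_div_sqrt :
    Continuous fun t : ℝ => Real.sin (Real.pi * t / 2) / Real.sqrt t := by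
  rw [continuous_iff_continuousAt]
  intro t
  rcases lt_trichotomy t 0 with ht | rfl | ht
  · refine (continuousAt_const (y := (0 : ℝ))).congr ?_
    filter_upwards [eventually_lt_nhds ht] with s hs
    rw [Real.sqrt_eq_zero_of_nonpos hs.le, div_zero]
  · have h0 : Filter.Tendsto (fun t : ℝ => Real.pi / 2 * Real.sqrt t) (nhds 0) (nhds 0) := by
      have : Continuous fun t : ℝ => Real.pi / 2 * Real.sqrt t := by fun_prop
      simpa using this.tendsto 0
    rw [ContinuousAt, Real.sqrt_zero, div_zero]
    refine squeeze_zero_norm (fun t => ?_) h0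
    rcases le_or_gt t 0 with ht | ht
    · simp [Real.sqrt_eq_zero_of_nonpos ht]
    · rw [norm_div, Real.norm_eq_abs, Real.norm_eq_abs, abs_of_nonneg (Real.sqrt_nonneg t),
        div_le_iff₀ (Real.sqrt_pos.mpr ht), mul_assoc, Real.mul_self_sqrt ht.le]
      refine Real.abs_sin_le_abs.trans_eq ?_
      rw [abs_of_nonneg (by positivity)]
      ring
  · exact ContinuousAt.div (by fun_prop) (by fun_prop) (Real.sqrt_pos.mpr ht).ne'

/-- The squares of `cos (π t / 2)` and `sin (π t / 2)` sum to one, with the sine factored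
through `√t`. -/
theorem cfc_cos_mul_self_add_cfc_sin_div_sqrt_mul_self {A : Type*} [CStarAlgebra A] {h : A}
    (hsa : IsSelfAdjoint h) (hpos : ∀ t ∈ spectrum ℝ h, 0 ≤ t) :
    cfc (fun t : ℝ => Real.cos (Real.pi / 2 * t)) h * cfc (fun t : ℝ => Real.cos (Real.pi / 2 * t)) h
      + cfc (fun t : ℝ => Real.sin (Real.pi * t / 2) / Real.sqrt t) h
        * cfc (fun t : ℝ => Real.sin (Real.pi * t / 2) / Real.sqrt t) h * h = 1 := by
  have hg := Real.continuous_sin_pi_div_two_div_sqrt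
  set g : ℝ → ℝ := fun t => Real.sin (Real.pi * t / 2) / Real.sqrt t with hg_def
  have hf : Continuous fun t : ℝ => Real.cos (Real.pi / 2 * t) := by fun_prop
  have hh : cfc g h * cfc g h * h = cfc (fun t => g t * g t * t) h := by
    rw [cfc_mul (fun t => g t * g t) (fun t => t) h (by fun_prop) (by fun_prop),
      cfc_mul g g h hg.continuousOn hg.continuousOn, cfc_id' ℝ h]
  rw [hh, ← cfc_mul _ _ h hf.continuousOn hf.continuousOn,
    ← cfc_add h _ _ (by fun_prop) (by fun_prop), ← cfc_const_one ℝ h]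
  refine cfc_congr fun t ht => ?_
  have key : g t * g t * t = Real.sin (Real.pi / 2 * t) ^ 2 := by
    rcases (hpos t ht).eq_or_lt with rfl | h0
    · simp
    · have := Real.sq_sqrt h0.le
      have h1 := (Real.sqrt_pos.mpr h0).ne'
      rw [hg_def, show Real.pi / 2 * t = Real.pi * t / 2 by ring]
      field_simp
      rw [this, mul_comm]
  simp only [key]
  rw [← sq, add_comm]
  exact Real.sin_sq_add_cos_sq _

/-- An element whose range and support positive parts are orthogonal squares to zero. -/
theorem CStarAlgebra.mul_self_eq_zero_of_mul_star_mul_star_mul {A : Type*} [CStarAlgebra A]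
    {v : A} (h : (v * star v) * (star v * v) = 0) : v * v = 0 := by
  have h1 : star v * (star v * v) = 0 := by
    rw [← CStarRing.star_mul_self_eq_zero_iff]
    simp only [star_mul, star_star]
    calc star v * v * v * (star v * (star v * v))
        = star v * v * ((v * star v) * (star v * v)) := by simp only [mul_assoc]
      _ = 0 := by rw [h, mul_zero]
  rw [← CStarRing.star_mul_self_eq_zero_iff]
  calc star (v * v) * (v * v) = star v * (star v * v) * v := by simp only [star_mul, mul_assoc]
    _ = 0 := by rw [h1, zero_mul]


/-- Let `A` be a unital C*-algebra and `v ∈ A`.  Set `a = v v*` and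
`b = v* v`, and assume `‖a‖ ≤ 1` and `a * b = 0`.  With
`g t = sin (π t / 2) / √t` (which is `0` at `t = 0`, as in Lean `0/0 = 0`) and
`w = cos ((π/2)(v v* + v* v)) + g(v v*) v − g(v* v) v*` (functional calculus), the element
`w` is a unitary lying in the closed unital *-subalgebra of `A` generated by `v`; moreover
(i) if `a c = c a = c` then `b (w* c w) = (w* c w) b = w* c w`, and
(ii) if `b c = c b = c` then `a (w c w*) = (w c w*) a = w c w*`. -/
theorem stmt1 {A : Type*} [CStarAlgebra A] (v : A)
    (hnorm : ‖v * star v‖ ≤ 1)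
    (horth : (v * star v) * (star v * v) = 0) :
    let g : ℝ → ℝ := fun t => Real.sin (Real.pi * t / 2) / Real.sqrt t
    let w : A := cfc (fun t : ℝ => Real.cos (Real.pi / 2 * t)) (v * star v + star v * v)
        + cfc g (v * star v) * v - cfc g (star v * v) * star v
    (star w * w = 1 ∧ w * star w = 1) ∧
    w ∈ StarAlgebra.elemental ℂ v ∧
    (∀ c : A, (v * star v) * c = c → c * (v * star v) = c →
      (star v * v) * (star w * c * w) = star w * c * w ∧
      (star w * c * w) * (star v * v) = star w * c * w) ∧
    (∀ c : A, (star v * v) * c = c → c * (star v * v) = c →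
      (v * star v) * (w * c * star w) = w * c * star w ∧
      (w * c * star w) * (v * star v) = w * c * star w) := by
  intro g w
  have hvv := CStarAlgebra.mul_self_eq_zero_of_mul_star_mul_star_mul horth
  have hvv' : star v * star v = 0 := by rw [← star_mul, hvv, star_zero]
  have hg : Continuous g := Real.continuous_sin_pi_div_two_div_sqrt
  have hf : Continuous fun t : ℝ => Real.cos (Real.pi / 2 * t) := by fun_prop
  have ha : IsSelfAdjoint (v * star v) := .mul_star_self v
  have hb : IsSelfAdjoint (star v * v) := .star_mul_self v
  have hpos : ∀ t ∈ spectrum ℝ (v * star v + star v * v), 0 ≤ t := by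
    have : v * star v + star v * v = star (v - star v) * (v - star v) := by
      simp only [star_sub, star_star, sub_mul, mul_sub, hvv, hvv']
      abel
    rw [this]
    exact spectrum_star_mul_self_nonneg
  have hone := cfc_cos_mul_self_add_cfc_sin_div_sqrt_mul_self (ha.add hb) hpos
  set h := v * star v + star v * v with h_def
  have hh : IsSelfAdjoint h := ha.add hb
  have hvh : v * h = v * star v * v := by
    rw [h_def, mul_add, ← mul_assoc, ← mul_assoc, hvv, zero_mul, zero_add]
  have hhv : h * v = v * star v * v := by
    rw [h_def, add_mul, mul_assoc (star v), hvv, mul_zero, add_zero]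
  have hsh : star v * h = star v * v * star v := by
    rw [h_def, mul_add, ← mul_assoc, ← mul_assoc, hvv', zero_mul, add_zero]
  have hhs : h * star v = star v * v * star v := by
    rw [h_def, add_mul, mul_assoc v, hvv', mul_zero, zero_add]
  have cv : Commute h v := hhv.trans hvh.symm
  have cs : Commute h (star v) := hhs.trans hsh.symm
  have hga : cfc g (v * star v) * v = cfc g h * v := by
    have : SemiconjBy v h (v * star v) := hvh
    rw [← (this.cfc_real ha hh hg).eq, (cv.cfc_real g).eq]
  have hgb : cfc g (star v * v) * star v = cfc g h * star v := by
    have : SemiconjBy (star v) h (star v * v) := hsh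
    rw [← (this.cfc_real hb hh hg).eq, (cs.cfc_real g).eq]
  have hCs : star (cfc (fun t : ℝ => Real.cos (Real.pi / 2 * t)) h)
      = cfc (fun t : ℝ => Real.cos (Real.pi / 2 * t)) h := cfc_predicate (p := IsSelfAdjoint) _ h
  have hSs : star (cfc g h) = cfc g h := cfc_predicate (p := IsSelfAdjoint) _ h
  have hC1 : ∀ c, h * c = c → cfc (fun t : ℝ => Real.cos (Real.pi / 2 * t)) h * c = 0 := by
    intro c hc
    simpa using cfc_real_mul_eq_smul_of_mul_eq_self hh hc hf
  have hS1 : ∀ c, h * c = c → cfc g h * c = c := by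
    intro c hc
    simpa [g] using cfc_real_mul_eq_smul_of_mul_eq_self hh hc hg
  have hmem : w ∈ StarAlgebra.elemental ℂ v := by
    have hv := StarAlgebra.elemental.self_mem ℂ v
    have hs := star_mem hv
    have hcl : IsClosed (StarAlgebra.elemental ℂ v : Set A) := StarAlgebra.elemental.isClosed ℂ v
    exact sub_mem (add_mem (cfc_mem (𝕜' := ℂ) _ (add_mem (mul_mem hv hs) (mul_mem hs hv)))
      (mul_mem (cfc_mem (𝕜' := ℂ) _ (mul_mem hv hs)) hv))
      (mul_mem (cfc_mem (𝕜' := ℂ) _ (mul_mem hs hv)) hs)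
  have hCv := cv.cfc_real (fun t : ℝ => Real.cos (Real.pi / 2 * t))
  have hCsv := cs.cfc_real (fun t : ℝ => Real.cos (Real.pi / 2 * t))
  have hSv := cv.cfc_real g
  have hSsv := cs.cfc_real g
  have hCS : Commute (cfc (fun t : ℝ => Real.cos (Real.pi / 2 * t)) h) (cfc g h) :=
    cfc_commute_cfc _ _ _
  change _ + cfc g h * cfc g h * h = 1 at hone
  have hw : w = cfc (fun t : ℝ => Real.cos (Real.pi / 2 * t)) h + cfc g h * (v - star v) := by
    simp only [w]
    rw [hga, hgb, mul_sub, add_sub_assoc]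
  clear_value w
  set C := cfc (fun t : ℝ => Real.cos (Real.pi / 2 * t)) h
  set S := cfc g h
  have hSy : Commute S (v - star v) := hSv.sub_right hSsv
  have hCy : Commute C (v - star v) := hCv.sub_right hCsv
  have hyy : (v - star v) * (v - star v) = -h := by
    simp only [h_def, sub_mul, mul_sub, hvv, hvv']
    abel
  have hsw : star w = C - S * (v - star v) := by
    rw [hw, star_add, star_mul, hCs, hSs, star_sub, star_star, ← neg_sub v, neg_mul, ← hSy.eq,
      ← sub_eq_add_neg]
  have hX : S * (v - star v) * (S * (v - star v)) = -(S * S * h) := by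
    rw [hSy.symm.mul_mul_mul_comm, hyy, mul_neg]
  have hCX : Commute C (S * (v - star v)) := hCS.mul_right hCy
  have hL : ∀ c, h * c = c → w * c = (v - star v) * c ∧ star w * c = -((v - star v) * c) := by
    intro c hc
    have : S * (v - star v) * c = (v - star v) * c := by rw [hSy.eq, mul_assoc, hS1 c hc]
    rw [hsw, hw, add_mul, sub_mul C, hC1 c hc, this, zero_add, zero_sub]
    exact ⟨rfl, rfl⟩
  have hwa : ∀ c, v * star v * c = c → star w * c = star v * c := by
    intro c hc
    have hvc : v * c = 0 := by
      rw [← hc, ← mul_assoc, ← mul_assoc, hvv, zero_mul, zero_mul]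
    have : h * c = c := by rw [h_def, add_mul, hc, mul_assoc, hvc, mul_zero, add_zero]
    rw [(hL c this).2, sub_mul, hvc, zero_sub, neg_neg]
  have hwb : ∀ c, star v * v * c = c → w * c = v * c := by
    intro c hc
    have hvc : star v * c = 0 := by
      rw [← hc, ← mul_assoc, ← mul_assoc, hvv', zero_mul, zero_mul]
    have : h * c = c := by rw [h_def, add_mul, hc, mul_assoc v, hvc, mul_zero, zero_add]
    rw [(hL c this).1, sub_mul, hvc, sub_zero]
  refine ⟨⟨?_, ?_⟩, hmem, fun c hc hc' => ⟨?_, ?_⟩, fun c hc hc' => ⟨?_, ?_⟩⟩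
  · rw [hsw, hw, sub_mul C, mul_add, mul_add, hX, ← hCX.eq, ← hone]
    abel
  · rw [hsw, hw, add_mul, mul_sub C, mul_sub (S * (v - star v)) C, hX, ← hCX.eq, ← hone]
    abel
  · rw [hwa c hc, ← mul_assoc, ← mul_assoc, mul_assoc (star v) v, mul_assoc (star v), hc]
  · have hcw : c * w = c * v := by
      have hc'' : v * star v * star c = star c := by
        rw [← ha.star_eq, ← star_mul, hc']
      simpa using congrArg star (hwa _ hc'')
    calc star w * c * w * (star v * v) = star w * (c * w) * (star v * v) := by
          rw [mul_assoc (star w)]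
      _ = star w * (c * (v * star v) * v) := by rw [hcw]; simp only [mul_assoc]
      _ = star w * c * w := by rw [hc', ← hcw, mul_assoc]
  · rw [hwb c hc, ← mul_assoc, ← mul_assoc, mul_assoc v (star v), mul_assoc v, hc]
  · have hcw : c * star w = c * star v := by
      have hc'' : star v * v * star c = star c := by
        rw [← hb.star_eq, ← star_mul, hc']
      simpa using congrArg star (hwb _ hc'')
    calc w * c * star w * (v * star v) = w * (c * star w) * (v * star v) := by
          rw [mul_assoc w]
      _ = w * (c * (star v * v) * star v) := by rw [hcw]; simp only [mul_assoc]
      _ = w * c * star w := by rw [hc', ← hcw, mul_assoc]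
end

section
/- Let A be a unital C*-algebra and let v_1, ..., v_n ∈ A satisfy: v_1* v_1 = v_2* v_2 = ⋯ = v_n* v_n; the n+1 elements v_1* v_1, v_1 v_1*, v_2 v_2*, ..., v_n v_n* are mutually orthogonal (the product of any two distinct ones is 0); and ‖v_1* v_1‖ = 1. Then there exists a unitary w ∈ A satisfying all of the following: (1) whenever E_1, ..., E_n ∈ A are mutually orthogonal positive elements such that v_1* v_1 commutes with each E_i and (v_i v_i*) E_i = v_i v_i* for each i = 1, ..., n, then for every 1 ≤ i ≤ n−1 the element w E_i lies in the norm closure of the set {(E_1 + E_i + E_{i+1}) x : x ∈ A}; (2) whenever D ⊆ A is a hereditary sub-C*-algebra containing v_i v_i* for all i = 1, ..., n, and d ∈ D satisfies d(v_1* v_1) = (v_1* v_1)d and v_n* d = 0, then w d lies in the norm closure of the linear span of {d' x : d' ∈ D, x ∈ A}; (3) whenever c ∈ A is positive with (v_1* v_1) c = c, then w c lies in the norm closure of the set {(v_1 v_1*) x : x ∈ A}. -/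
open scoped Matrix

theorem eq_zero_star_mul {A : Type*} [CStarAlgebra A] {x b : A} (h : x * star x * b = 0) :
    star x * b = 0 := by
  rw [← CStarRing.star_mul_self_eq_zero_iff, star_mul, star_star, mul_assoc, ← mul_assoc x, h,
    mul_zero]

/-- In a C*-algebra, `x` lies in the closed right ideal generated by `x * star x`. -/
theorem mem_closure_of_mul_star_mem {A : Type*} [CStarAlgebra A] [PartialOrder A]
    [StarOrderedRing A] {J : AddSubgroup A} (hJ : ∀ x ∈ J, ∀ y, x * y ∈ J) {x : A}
    (hx : x * star x ∈ J) (y : A) : x * y ∈ closure (J : Set A) := by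
  suffices hxJ : x ∈ closure (J : Set A) from
    map_mem_closure (f := fun z => z * y) (by fun_prop) hxJ fun z hz => hJ z hz y
  set h := x * star x with hh
  have h0 : 0 ≤ h := mul_star_self_nonneg x
  have hspec : ∀ t ∈ spectrum ℝ h, 0 ≤ t := fun t ht => spectrum_nonneg_of_nonneg h0 ht
  rw [Metric.mem_closure_iff]
  intro δ hδ
  set ε : ℝ := δ ^ 2 / 2 with hε
  have hε0 : 0 < ε := by positivity
  have hpos : ∀ t ∈ spectrum ℝ h, t + ε ≠ 0 := fun t ht => by linarith [hspec t ht]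
  have hfc : ContinuousOn (fun t : ℝ => (t + ε)⁻¹) (spectrum ℝ h) :=
    ContinuousOn.inv₀ (by fun_prop) hpos
  have hkc : ContinuousOn (fun t : ℝ => ε * (t + ε)⁻¹) (spectrum ℝ h) :=
    continuousOn_const.mul hfc
  refine ⟨h * (cfc (fun t : ℝ => (t + ε)⁻¹) h * x), hJ _ hx _, ?_⟩
  have hmul : ∀ f : ℝ → ℝ, ContinuousOn f (spectrum ℝ h) →
      h * cfc f h = cfc (fun t => t * f t) h := by
    intro f hf
    rw [cfc_mul (fun t => t) f h continuousOn_id hf, cfc_id' ℝ h]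
  have hk : x - h * (cfc (fun t : ℝ => (t + ε)⁻¹) h * x)
      = cfc (fun t : ℝ => ε * (t + ε)⁻¹) h * x := by
    have e : cfc (fun t : ℝ => ε * (t + ε)⁻¹) h
        = 1 - h * cfc (fun t : ℝ => (t + ε)⁻¹) h := by
      rw [hmul _ hfc, ← cfc_one ℝ h,
        ← cfc_sub 1 (fun t => t * (t + ε)⁻¹) h continuousOn_const (continuousOn_id.mul hfc)]
      refine cfc_congr fun t ht => ?_
      have := hpos t ht
      simp only [Pi.one_apply]
      field_simp
      ring
    rw [e, sub_mul, one_mul, mul_assoc h]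
  rw [dist_eq_norm, hk]
  have hsa : star (cfc (fun t : ℝ => ε * (t + ε)⁻¹) h) = cfc (fun t : ℝ => ε * (t + ε)⁻¹) h :=
    (cfc_predicate (fun t : ℝ => ε * (t + ε)⁻¹) h : IsSelfAdjoint _)
  have hsq : ‖cfc (fun t : ℝ => ε * (t + ε)⁻¹) h * x‖ ^ 2 ≤ ε := by
    rw [sq, ← CStarRing.norm_self_mul_star, star_mul, hsa, mul_assoc, ← mul_assoc x, ← hh,
      hmul _ hkc, ← cfc_mul _ (fun t => t * (ε * (t + ε)⁻¹)) h hkc (continuousOn_id.mul hkc)]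
    refine norm_cfc_le hε0.le fun t ht => ?_
    have h1 := hspec t ht
    have h2 : 0 < t + ε := by linarith
    rw [Real.norm_of_nonneg (by positivity)]
    have : ε * (t + ε)⁻¹ * (t * (ε * (t + ε)⁻¹)) = ε * (ε * t / (t + ε) ^ 2) := by
      field_simp
    rw [this]
    refine mul_le_of_le_one_right hε0.le ?_
    rw [div_le_one (by positivity)]
    nlinarith [mul_nonneg h1 hε0.le]
  refine lt_of_pow_lt_pow_left₀ 2 hδ.le (hsq.trans_lt ?_)
  rw [hε]
  linarith [pow_pos hδ 2]

/-- The square matrix whose column `j < n` is `c j • e j - s j • e (j + 1)`, with the last column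
completing the other ones to an orthonormal basis when the rotations `(c j, s j)` are performed
one after the other. -/
def cycleMatrix {R : Type*} [CommRing R] (n : ℕ) (c s : ℕ → R) :
    Matrix (Fin (n + 1)) (Fin (n + 1)) R :=
  Matrix.of fun i j =>
    if (j : ℕ) = n then (∏ l ∈ Finset.range i, c l) * ∏ l ∈ Finset.Ico (i : ℕ) n, s l
    else if i = j then c j else if (i : ℕ) = j + 1 then - s j else 0

section CommRing
variable {R : Type*} [CommRing R] {c s : ℕ → R}

theorem sum_prod_sq_eq_one (hcs : ∀ k, c k ^ 2 + s k ^ 2 = 1)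
    (hsc : ∀ k l, k < l → s k * c l = 0) (n : ℕ) :
    ∑ i ∈ Finset.range (n + 1),
      ((∏ l ∈ Finset.range i, c l) * ∏ l ∈ Finset.Ico i n, s l) ^ 2 = 1 := by
  have hc : ∀ n, (∏ l ∈ Finset.range n, c l ^ 2) * c n ^ 2 = c n ^ 2 := by
    intro n
    have : ∀ m ≤ n, (∏ l ∈ Finset.range m, c l ^ 2) * c n ^ 2 = c n ^ 2 := by
      intro m hm
      induction m with
      | zero => simp
      | succ m ih =>
        rw [Finset.prod_range_succ]
        linear_combination ih (by omega) + (∏ l ∈ Finset.range m, c l ^ 2) * c n ^ 2 * hcs m -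
          (∏ l ∈ Finset.range m, c l ^ 2) * s m * c n * hsc m n (by omega)
    exact this n le_rfl
  induction n with
  | zero => simp
  | succ n ih =>
    rw [Finset.sum_range_succ]
    have : ∀ i ∈ Finset.range (n + 1),
        ((∏ l ∈ Finset.range i, c l) * ∏ l ∈ Finset.Ico i (n + 1), s l) ^ 2
        = ((∏ l ∈ Finset.range i, c l) * ∏ l ∈ Finset.Ico i n, s l) ^ 2 * s n ^ 2 := by
      intro i hi
      rw [Finset.prod_Ico_succ_top (by simpa [Nat.lt_succ_iff] using hi)]
      ring
    rw [Finset.sum_congr rfl this, ← Finset.sum_mul, ih]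
    simp only [Finset.Ico_self, Finset.prod_empty, mul_one, Finset.prod_range_succ, mul_pow,
      ← Finset.prod_pow]
    rw [hc n, one_mul]
    linear_combination hcs n

theorem cycleMatrix_transpose_mul_self (hcs : ∀ k, c k ^ 2 + s k ^ 2 = 1)
    (hsc : ∀ k l, k < l → s k * c l = 0) (n : ℕ) :
    (cycleMatrix n c s)ᵀ * cycleMatrix n c s = 1 := by
  have hcol : ∀ (j : Fin (n + 1)) (hj : (j : ℕ) < n) (f : Fin (n + 1) → R),
      ∑ i, cycleMatrix n c s i j * f i = c j * f j - s j * f ⟨j + 1, by omega⟩ := by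
    intro j hj f
    have hne : j ≠ (⟨j + 1, by omega⟩ : Fin (n + 1)) := by simp [Fin.ext_iff]
    rw [Finset.sum_eq_add j ⟨j + 1, by omega⟩ hne]
    · simp only [cycleMatrix, Matrix.of_apply, if_neg hj.ne, if_true, if_neg hne.symm]
      ring
    · rintro i - ⟨h1, h2⟩
      have h3 : ¬ (i : ℕ) = j + 1 := fun h => h2 (Fin.ext h)
      simp [cycleMatrix, hj.ne, h1, h3]
    · simp
    · simp
  have horth : ∀ i j : Fin (n + 1), (i : ℕ) < j →
      ∑ k, cycleMatrix n c s k i * cycleMatrix n c s k j = 0 := by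
    intro i j hij
    rw [hcol i (by omega)]
    by_cases hj : (j : ℕ) = n
    · simp only [cycleMatrix, Matrix.of_apply, if_pos hj]
      rw [Finset.prod_range_succ, Finset.prod_eq_prod_Ico_succ_bot (by omega : (i : ℕ) < n)]
      ring
    · have h1 : ¬ i = j := fun h => by simp [h] at hij
      have h2 : ¬ (i : ℕ) = j + 1 := by omega
      simp only [cycleMatrix, Matrix.of_apply, if_neg hj, if_neg h1, if_neg h2]
      by_cases h3 : (i : ℕ) + 1 = j
      · simp [h3, hsc i j hij]
      · have h4 : ¬ (i : ℕ) = j := by omega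
        simp [h3, h4, Fin.ext_iff]
  ext i j
  rw [Matrix.mul_apply]
  simp only [Matrix.transpose_apply]
  rcases lt_trichotomy (i : ℕ) j with h | h | h
  · rw [horth i j h, Matrix.one_apply_ne (by rintro rfl; simp at h)]
  · obtain rfl := Fin.ext h
    rw [Matrix.one_apply_eq]
    by_cases hi : (i : ℕ) = n
    · simp only [cycleMatrix, Matrix.of_apply, if_pos hi, ← sq]
      rw [← sum_prod_sq_eq_one hcs hsc n, Finset.sum_range]
    · rw [hcol i (by omega)]
      simp only [cycleMatrix, Matrix.of_apply, if_neg hi, Fin.ext_iff]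
      simp only [if_true, Nat.succ_ne_self, if_false]
      linear_combination hcs i
  · rw [Finset.sum_congr rfl fun k _ => mul_comm _ _, horth j i h,
      Matrix.one_apply_ne (by rintro rfl; simp at h)]

theorem smul_cycleMatrix_sub_one {n : ℕ} {e : R} (hs : ∀ k < n, e * s k = s k)
    (hc : ∀ k < n, e * (c k - 1) = c k - 1) :
    e • (cycleMatrix n c s - 1) = cycleMatrix n c s - 1 := by
  have hprod : ∀ m ≤ n, e * ((∏ l ∈ Finset.range m, c l) - 1)
      = (∏ l ∈ Finset.range m, c l) - 1 := by
    intro m hm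
    induction m with
    | zero => simp
    | succ m ih =>
      rw [Finset.prod_range_succ]
      linear_combination ih (by omega) + (∏ l ∈ Finset.range m, c l) * hc m (by omega)
  ext i j
  simp only [cycleMatrix, Matrix.smul_apply, Matrix.sub_apply, Matrix.of_apply, smul_eq_mul]
  by_cases hj : (j : ℕ) = n
  · by_cases hij : i = j
    · subst hij
      simpa [hj] using hprod n le_rfl
    · have hi : (i : ℕ) < n := by
        have : (i : ℕ) ≠ j := fun h => hij (Fin.ext h)
        omega
      rw [if_pos hj, Matrix.one_apply_ne hij, sub_zero,
        Finset.prod_eq_prod_Ico_succ_bot hi]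
      linear_combination (∏ l ∈ Finset.range i, c l) * (∏ l ∈ Finset.Ico ((i : ℕ) + 1) n, s l) *
        hs i hi
  · have hj' : (j : ℕ) < n := by omega
    by_cases hij : i = j
    · subst hij
      simpa [hj] using hc i hj'
    · by_cases h : (i : ℕ) = j + 1
      · simp [hj, hij, h, Matrix.one_apply_ne hij, hs j hj']
      · simp [hj, hij, h, Matrix.one_apply_ne hij]

end CommRing

/-- The real functions describing a sequence of rotations performed one after the other. -/
theorem exists_successive_rotations (X : Set ℝ) (n : ℕ) :
    ∃ (c s : ℕ → C(X, ℝ)) (K L : C(X, ℝ)),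
      (∀ k, c k ^ 2 + s k ^ 2 = 1) ∧ (∀ k l, k < l → s k * c l = 0) ∧
      (∀ k < n, (K * (ContinuousMap.id ℝ).restrict X) * s k = s k) ∧
      (∀ k < n, (K * (ContinuousMap.id ℝ).restrict X) * (c k - 1) = c k - 1) ∧
      c 0 = L * (1 - (ContinuousMap.id ℝ).restrict X) := by
  let q : ℕ → ℝ → ℝ := fun k t => max 0 (min 1 ((n + 2) * t - n + k))
  have hqc : ∀ k, Continuous (q k) := fun k => by fun_prop
  have hq0 : ∀ k t, 0 ≤ q k t := fun k t => le_max_left _ _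
  have hq1 : ∀ k t, q k t ≤ 1 := fun k t => max_le zero_le_one (min_le_left _ _)
  have hn : (0 : ℝ) < 1 / (n + 2) := by positivity
  let M : ℝ → ℝ := fun t => (max t (1 / (n + 2)))⁻¹
  have hM0 : ∀ t : ℝ, 0 < max t (1 / ((n : ℝ) + 2)) := fun t => lt_max_of_lt_right hn
  have hM : Continuous M := Continuous.inv₀ (by fun_prop) fun t => (hM0 t).ne'
  have hq_small : ∀ k < n, ∀ t, M t * t = 1 ∨ q k t = 0 := by
    intro k hk t
    rcases le_total (1 / ((n : ℝ) + 2)) t with h | h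
    · left
      simp only [M, max_eq_left h]
      exact inv_mul_cancel₀ (hn.trans_le h).ne'
    · right
      refine max_eq_left ((min_le_right _ _).trans ?_)
      have : (k : ℝ) + 1 ≤ n := by exact_mod_cast hk
      rw [le_div_iff₀ (by positivity)] at h
      linarith
  have hq_large : ∀ t, M (1 - t) * (1 - t) = 1 ∨ q 0 t = 1 := by
    intro t
    rcases le_total (1 / ((n : ℝ) + 2)) (1 - t) with h | h
    · left
      simp only [M, max_eq_left h]
      exact inv_mul_cancel₀ (hn.trans_le h).ne'
    · right
      rw [le_div_iff₀ (by positivity)] at h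
      have : (1 : ℝ) ≤ (n + 2) * t - n + (0 : ℕ) := by push_cast; linarith
      simp only [q, min_eq_left this]
      exact max_eq_right zero_le_one
  have hq_succ : ∀ k l, k < l → ∀ t, q k t = 0 ∨ q l t = 1 := by
    intro k l hkl t
    have hkl' : (k : ℝ) + 1 ≤ l := by exact_mod_cast hkl
    rcases le_total ((n + 2) * t - n + k) 0 with h | h
    · exact Or.inl (max_eq_left ((min_le_right _ _).trans h))
    · right
      have : (1 : ℝ) ≤ (n + 2) * t - n + l := by linarith
      simp only [q, min_eq_left this]
      exact max_eq_right zero_le_one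
  have hr : ∀ k, Continuous fun t => √(1 - q k t ^ 2) := fun k => by fun_prop
  refine ⟨fun k => ⟨fun t => √(1 - q k t ^ 2), (hr k).comp continuous_subtype_val⟩,
    fun k => ⟨fun t => q k t, (hqc k).comp continuous_subtype_val⟩,
    ⟨fun t => M t, hM.comp continuous_subtype_val⟩,
    ⟨fun t => √(1 - q 0 t ^ 2) * M (1 - t), Continuous.comp
      (g := fun t : ℝ => √(1 - q 0 t ^ 2) * M (1 - t)) (by fun_prop) continuous_subtype_val⟩,
    fun k => ?_, fun k l hkl => ?_, fun k hk => ?_, fun k hk => ?_, ?_⟩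
  all_goals
    ext t
    simp only [ContinuousMap.add_apply, ContinuousMap.mul_apply, ContinuousMap.pow_apply,
      ContinuousMap.sub_apply, ContinuousMap.one_apply, ContinuousMap.zero_apply,
      ContinuousMap.coe_mk, ContinuousMap.restrict_apply, ContinuousMap.id_apply]
  · rw [Real.sq_sqrt (by nlinarith [hq0 k t, hq1 k t])]
    ring
  · rcases hq_succ k l hkl t with h | h <;> simp [h]
  · rcases hq_small k hk t with h | h <;> simp [h]
  · rcases hq_small k hk t with h | h <;> simp [h]
  · rcases hq_large t with h | h
    · rw [mul_assoc, h, mul_one]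
    · simp [h]


theorem exists_unitary_of_orthogonal {A R : Type*} [Ring A] [StarRing A] [CommRing R]
    (ψ : R →+* A) (hψ : ∀ r, star (ψ r) = ψ r) {m : ℕ} (T K : R) (V : Fin m → A)
    (hV : ∀ i j, star (V i) * V j = if i = j then ψ T else 0)
    (W : Matrix (Fin m) (Fin m) R) (hW : Wᵀ * W = 1) (hKT : (K * T) • (W - 1) = W - 1) :
    ∃ w : A, (star w * w = 1 ∧ w * star w = 1) ∧
      ∀ b, w * b = b + ∑ j, ∑ i, V i * (ψ (K * (W - 1) i j) * (star (V j) * b)) := by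
  let X : Matrix Unit (Fin m) A := Matrix.of fun _ i => V i
  have hX : Xᴴ * X = (T • (1 : Matrix (Fin m) (Fin m) R)).map ψ := by
    ext i j
    simp only [Matrix.mul_apply, X, Matrix.conjTranspose_apply, Matrix.of_apply, hV,
      Finset.univ_unique, Finset.sum_singleton, Matrix.map_apply, Matrix.smul_apply,
      Matrix.one_apply, smul_eq_mul]
    split_ifs <;> simp
  let P : Matrix (Fin m) (Fin m) R → Matrix Unit Unit A := fun G => X * G.map ψ * Xᴴ
  have hPmul : ∀ G H, P G * P H = P (T • (G * H)) := by
    intro G H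
    have : P G * P H = X * (G.map ψ * (Xᴴ * X) * H.map ψ) * Xᴴ := by
      simp only [P, Matrix.mul_assoc]
    rw [this, hX, ← Matrix.map_mul, ← Matrix.map_mul]
    simp [P]
  have hPadd : ∀ G H, P G + P H = P (G + H) := by
    intro G H
    simp only [P]
    rw [Matrix.map_add ψ (map_add ψ), Matrix.mul_add, Matrix.add_mul]
  have hPstar : ∀ G, (P G)ᴴ = P Gᵀ := by
    intro G
    have : (G.map ψ)ᴴ = Gᵀ.map ψ := by
      ext i j
      simp [hψ]
    simp only [P, Matrix.conjTranspose_mul, Matrix.conjTranspose_conjTranspose, this,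
      Matrix.mul_assoc]
  have hP0 : P 0 = 0 := by simp [P]
  set F := W - 1 with hF
  have hW1 : W = F + 1 := by simp [hF]
  have key : ∀ F₁ F₂ : Matrix (Fin m) (Fin m) R, (K * T) • F₁ = F₁ → F₁ + F₂ + F₁ * F₂ = 0 →
      (1 + P (K • F₁)) * (1 + P (K • F₂)) = 1 := by
    intro F₁ F₂ h1 h2
    have : (1 + P (K • F₁)) * (1 + P (K • F₂))
        = 1 + (P (K • F₁) + P (K • F₂) + P (K • F₁) * P (K • F₂)) := by noncomm_ring
    rw [this, hPmul, hPadd, hPadd]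
    have e : K • F₁ + K • F₂ + T • (K • F₁ * K • F₂) = K • (F₁ + F₂ + F₁ * F₂) := by
      have h3 : (K * T) • (F₁ * F₂) = F₁ * F₂ := by rw [← Matrix.smul_mul, h1]
      rw [smul_add, smul_add]
      conv_rhs => rw [← h3]
      simp only [Matrix.smul_mul, Matrix.mul_smul, smul_smul]
      ring_nf
    rw [e, h2, smul_zero, hP0, add_zero]
  have hKT' : (K * T) • Fᵀ = Fᵀ := by rw [← Matrix.transpose_smul, hKT]
  have hW2 : W * Wᵀ = 1 := mul_eq_one_comm.mp hW
  have hleft : (1 + P (K • Fᵀ)) * (1 + P (K • F)) = 1 := by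
    refine key _ _ hKT' ?_
    rw [hW1, Matrix.transpose_add, Matrix.transpose_one] at hW
    have : Fᵀ + F + Fᵀ * F = (Fᵀ + 1) * (F + 1) - 1 := by noncomm_ring
    rw [this, hW, sub_self]
  have hright : (1 + P (K • F)) * (1 + P (K • Fᵀ)) = 1 := by
    refine key _ _ hKT ?_
    rw [hW1, Matrix.transpose_add, Matrix.transpose_one] at hW2
    have : F + Fᵀ + F * Fᵀ = (F + 1) * (Fᵀ + 1) - 1 := by noncomm_ring
    rw [this, hW2, sub_self]
  have hst : (1 + P (K • F))ᴴ = 1 + P (K • Fᵀ) := by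
    rw [Matrix.conjTranspose_add, hPstar, Matrix.transpose_smul, Matrix.conjTranspose_one]
  rw [← hst] at hleft hright
  have hentry : ∀ M N : Matrix Unit Unit A, (M * N) () () = M () () * N () () := by
    intro M N
    simp [Matrix.mul_apply]
  refine ⟨(1 + P (K • F)) () (), ⟨?_, ?_⟩, fun b => ?_⟩
  · have := congrFun (congrFun hleft ()) ()
    rwa [hentry, Matrix.conjTranspose_apply, Matrix.one_apply_eq] at this
  · have := congrFun (congrFun hright ()) ()
    rwa [hentry, Matrix.conjTranspose_apply, Matrix.one_apply_eq] at this
  · simp only [Matrix.add_apply, Matrix.one_apply_eq, add_mul, one_mul, P, Matrix.mul_apply,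
      Finset.sum_mul, X, Matrix.conjTranspose_apply, Matrix.of_apply, Matrix.map_apply,
      Matrix.smul_apply, smul_eq_mul, mul_assoc]

section Terms
variable {R : Type*} [CommRing R] {c s : ℕ → R} {n : ℕ}

theorem cycleMatrix_zero_zero (hn : 0 < n) : cycleMatrix n c s 0 0 = c 0 := by
  simp [cycleMatrix, hn.ne]

theorem cycleMatrix_sub_one_eq_zero {i j : Fin (n + 1)} (hj : (j : ℕ) ≠ n) (hij : i ≠ j)
    (hij' : (i : ℕ) ≠ j + 1) : (cycleMatrix n c s - 1) i j = 0 := by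
  simp [cycleMatrix, hj, hij, hij', Matrix.one_apply_ne hij]

end Terms

theorem sum_mem_closure {A ι : Type*} [CStarAlgebra A] {J : AddSubgroup A} [Fintype ι] {f : ι → A}
    (hf : ∀ i, f i ∈ closure (J : Set A)) : ∑ i, f i ∈ closure (J : Set A) := by
  rw [← AddSubgroup.topologicalClosure_coe]
  exact sum_mem fun i _ => by
    rw [← SetLike.mem_coe, AddSubgroup.topologicalClosure_coe]
    exact hf i

theorem add_mem_closure {A : Type*} [CStarAlgebra A] {J : AddSubgroup A} {x y : A}
    (hx : x ∈ closure (J : Set A)) (hy : y ∈ closure (J : Set A)) :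
    x + y ∈ closure (J : Set A) := by
  rw [← AddSubgroup.topologicalClosure_coe] at *
  exact add_mem hx hy

/-- The unitary implementing the successive rotations, with `v₀` the square root of
`star (v i) * v i`. -/
theorem exists_rotation_unitary {A : Type*} [CStarAlgebra A] [PartialOrder A] [StarOrderedRing A]
    (n : ℕ) (hn : 0 < n) (v : Fin n → A) (a : A) (ha : 0 ≤ a) (hva : ∀ i, star (v i) * v i = a)
    (hav : ∀ i, a * (v i * star (v i)) = 0)
    (hvv : ∀ i j, i ≠ j → (v i * star (v i)) * (v j * star (v j)) = 0) :
    ∃ (w u y : A) (g : Fin (n + 1) → Fin (n + 1) → A),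
      (star w * w = 1 ∧ w * star w = 1) ∧
      (∀ b, w * b = b + ∑ j, ∑ i, (Fin.cons u v : Fin (n + 1) → A) i *
        (g i j * (star ((Fin.cons u v : Fin (n + 1) → A) j) * b))) ∧
      (∀ i j : Fin (n + 1), (j : ℕ) ≠ n → i ≠ j → (i : ℕ) ≠ j + 1 → g i j = 0) ∧
      star u = u ∧ (∀ b, Commute a b → Commute u b ∧ ∀ i j, Commute (g i j) b) ∧
      1 + u * g 0 0 * u = y * (1 - a) := by
  have hsa : IsSelfAdjoint a := ha.isSelfAdjoint
  obtain ⟨c, s, K, L, hcs, hsc, hs, hc, hL⟩ := exists_successive_rotations (spectrum ℝ a) n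
  set T : C(spectrum ℝ a, ℝ) := (ContinuousMap.id ℝ).restrict (spectrum ℝ a) with hT
  let ψ : C(spectrum ℝ a, ℝ) →+* A := (cfcHom hsa : C(spectrum ℝ a, ℝ) →⋆ₐ[ℝ] A)
  have hψT : ψ T = a := cfcHom_id hsa
  have hψstar : ∀ f, star (ψ f) = ψ f := fun f =>
    (map_star (cfcHom hsa : C(spectrum ℝ a, ℝ) →⋆ₐ[ℝ] A) f).symm.trans
      (congrArg ψ (star_trivial f))
  have hψcomm : ∀ b, Commute a b → ∀ f, Commute (ψ f) b := fun b hb f =>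
    IsSelfAdjoint.commute_cfcHom hsa hsa hb f
  let r : C(spectrum ℝ a, ℝ) := ⟨fun t => √t, by fun_prop⟩
  have hrr : r * r = T := by
    ext t
    exact Real.mul_self_sqrt (spectrum_nonneg_of_nonneg ha t.2)
  have huu : ψ r * ψ r = a := by rw [← map_mul, hrr, hψT]
  have hav' : ∀ i, a * v i = 0 := by
    intro i
    have := eq_zero_star_mul (x := v i) (b := a) (by
      have := congrArg star (hav i)
      rwa [star_mul, star_mul, star_star, hsa.star_eq, star_zero] at this)
    rw [← star_eq_zero, star_mul, hsa.star_eq, this]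
  have huv : ∀ i, ψ r * v i = 0 := by
    intro i
    rw [← CStarRing.star_mul_self_eq_zero_iff, star_mul, hψstar, mul_assoc, ← mul_assoc (ψ r), huu,
      hav', mul_zero]
  have hvu : ∀ i, star (v i) * ψ r = 0 := by
    intro i
    rw [← hψstar, ← star_mul, huv, star_zero]
  have hvv' : ∀ i j, i ≠ j → star (v i) * v j = 0 := by
    intro i j hij
    have h := eq_zero_star_mul (hvv i j hij)
    have h2 := eq_zero_star_mul (x := v j) (b := v i) (by
      rw [← star_eq_zero, star_mul, star_mul, star_star, h])
    rw [← star_eq_zero, star_mul, star_star, h2]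
  obtain ⟨w, hw, hwb⟩ := exists_unitary_of_orthogonal ψ hψstar T K
    (Fin.cons (ψ r) v : Fin (n + 1) → A) (by
      intro i j
      rw [hψT]
      induction i using Fin.cases with
      | zero =>
        induction j using Fin.cases with
        | zero => simp [hψstar, huu]
        | succ j => simp [hψstar, huv, (Fin.succ_ne_zero j).symm]
      | succ i =>
        induction j using Fin.cases with
        | zero => simp [hvu]
        | succ j =>
          by_cases hij : i = j
          · simp [hij, hva]
          · simp [hij, hvv' i j hij])
    (cycleMatrix n c s) (cycleMatrix_transpose_mul_self hcs hsc n)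
    (smul_cycleMatrix_sub_one hs hc)
  refine ⟨w, ψ r, ψ L, fun i j => ψ (K * (cycleMatrix n c s - 1) i j), hw, hwb, ?_, hψstar r,
    fun b hb => ⟨hψcomm b hb r, fun i j => hψcomm b hb _⟩, ?_⟩
  · intro i j hj hij hij'
    simp only [cycleMatrix_sub_one_eq_zero hj hij hij', mul_zero, map_zero]
  · have h1a : 1 - a = ψ (1 - T) := by rw [map_sub, map_one, hψT]
    rw [h1a, ← map_one ψ, ← map_mul, ← map_mul, ← map_mul, ← map_add, ← hL,
      Matrix.sub_apply, cycleMatrix_zero_zero hn, Matrix.one_apply_eq]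
    congr 1
    linear_combination hc 0 hn + K * (c 0 - 1) * hrr


/-- Given `v 0, …, v (n-1)` in a unital C*-algebra `A` with all
`(v i)* (v i)` equal, with the `n+1` elements `(v 0)* (v 0), (v 0)(v 0)*, …, (v (n-1))(v (n-1))*`
mutually orthogonal, and with `‖(v 0)* (v 0)‖ = 1`, there is a unitary `w ∈ A` satisfying the
three properties of Lemma 3.3 of the paper (here indices are 0-based, so `v 0` plays the role
of `v₁` and `v (n-1)` the role of `vₙ`). -/
theorem stmt2 {A : Type*} [CStarAlgebra A] [PartialOrder A] [StarOrderedRing A]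
    (n : ℕ) (hn : 0 < n) (v : Fin n → A)
    (heq : ∀ i j : Fin n, star (v i) * v i = star (v j) * v j)
    (horth : ∀ i j : Fin (n + 1), i ≠ j →
      (Fin.cons (star (v ⟨0, hn⟩) * v ⟨0, hn⟩) (fun k : Fin n => v k * star (v k))
        : Fin (n + 1) → A) i *
      (Fin.cons (star (v ⟨0, hn⟩) * v ⟨0, hn⟩) (fun k : Fin n => v k * star (v k))
        : Fin (n + 1) → A) j = 0)
    (hnorm : ‖star (v ⟨0, hn⟩) * v ⟨0, hn⟩‖ = 1) :
    ∃ w : A, (star w * w = 1 ∧ w * star w = 1) ∧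
      -- (1)
      (∀ E : Fin n → A, (∀ i, 0 ≤ E i) → (∀ i j, i ≠ j → E i * E j = 0) →
        (∀ i, (star (v ⟨0, hn⟩) * v ⟨0, hn⟩) * E i = E i * (star (v ⟨0, hn⟩) * v ⟨0, hn⟩)) →
        (∀ i, (v i * star (v i)) * E i = v i * star (v i)) →
        ∀ (i : Fin n) (h : (i : ℕ) + 1 < n),
          w * E i ∈
            closure (Set.range fun x : A => (E ⟨0, hn⟩ + E i + E ⟨(i : ℕ) + 1, h⟩) * x)) ∧
      -- (2)
      (∀ D : NonUnitalStarSubalgebra ℂ A, IsClosed (D : Set A) →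
        (∀ x d : A, 0 ≤ x → x ≤ d → d ∈ D → x ∈ D) →
        (∀ i, v i * star (v i) ∈ D) →
        ∀ d ∈ D, d * (star (v ⟨0, hn⟩) * v ⟨0, hn⟩) = (star (v ⟨0, hn⟩) * v ⟨0, hn⟩) * d →
          star (v ⟨n - 1, Nat.sub_lt hn Nat.one_pos⟩) * d = 0 →
          w * d ∈
            closure (Submodule.span ℂ {y : A | ∃ d' ∈ D, ∃ x : A, y = d' * x} : Set A)) ∧
      -- (3)
      (∀ c : A, 0 ≤ c → (star (v ⟨0, hn⟩) * v ⟨0, hn⟩) * c = c →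
        w * c ∈ closure (Set.range fun x : A => (v ⟨0, hn⟩ * star (v ⟨0, hn⟩)) * x)) := by
  have hva : ∀ i, star (v i) * v i = star (v ⟨0, hn⟩) * v ⟨0, hn⟩ := fun i => heq i _
  obtain ⟨w, u, y, g, hw, hwb, hg, hu, hcomm, hy⟩ := exists_rotation_unitary n hn v
    (star (v ⟨0, hn⟩) * v ⟨0, hn⟩) (star_mul_self_nonneg _) hva
    (fun i => by simpa using horth 0 i.succ (Fin.succ_ne_zero i).symm)
    (fun i j hij => by simpa using horth i.succ j.succ (by simpa using hij))
  have hav : ∀ i, star (v i) * (star (v ⟨0, hn⟩) * v ⟨0, hn⟩) = 0 := fun i =>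
    eq_zero_star_mul (by simpa using horth i.succ 0 (Fin.succ_ne_zero i))
  set a := star (v ⟨0, hn⟩) * v ⟨0, hn⟩ with ha
  refine ⟨w, hw, ?_, ?_, ?_⟩
  · intro E hE hEE haE hvE i hi
    set S := E ⟨0, hn⟩ + E i + E ⟨(i : ℕ) + 1, hi⟩ with hS
    let J : AddSubgroup A := (AddMonoidHom.mulLeft S).range
    have hJ : (J : Set A) = Set.range fun x : A => S * x := rfl
    rw [← hJ]
    have hJmul : ∀ x ∈ J, ∀ y, x * y ∈ J := by
      rintro _ ⟨x, rfl⟩ y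
      exact ⟨x * y, (mul_assoc _ _ _).symm⟩
    have hEsq : ∀ k : Fin n, (k = ⟨0, hn⟩ ∨ k = i ∨ k = ⟨(i : ℕ) + 1, hi⟩) →
        E k * E k ∈ J := by
      intro k hk
      have hne : i ≠ ⟨(i : ℕ) + 1, hi⟩ := by simp [Fin.ext_iff]
      have hne' : (⟨0, hn⟩ : Fin n) ≠ ⟨(i : ℕ) + 1, hi⟩ := by simp [Fin.ext_iff]
      by_cases h0 : i = ⟨0, hn⟩
      · rw [← h0] at hk
        rcases hk with rfl | rfl | rfl
        · refine ⟨(2⁻¹ : ℝ) • E k, ?_⟩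
          change S * _ = _
          rw [mul_smul_comm, hS, ← h0, add_mul, add_mul, hEE _ _ hne.symm, add_zero, ← two_smul ℝ,
            smul_smul]
          norm_num
        · refine ⟨(2⁻¹ : ℝ) • E k, ?_⟩
          change S * _ = _
          rw [mul_smul_comm, hS, ← h0, add_mul, add_mul, hEE _ _ hne.symm, add_zero, ← two_smul ℝ,
            smul_smul]
          norm_num
        · refine ⟨E ⟨(i : ℕ) + 1, hi⟩, ?_⟩
          change S * _ = _
          rw [hS, ← h0, add_mul, add_mul, hEE _ _ hne, add_zero, zero_add]
      · refine ⟨E k, ?_⟩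
        change S * _ = _
        rcases hk with rfl | rfl | rfl
        · rw [hS, add_mul, add_mul, hEE _ _ h0, hEE _ _ hne'.symm, add_zero, add_zero]
        · rw [hS, add_mul, add_mul, hEE _ _ (Ne.symm h0), hEE _ _ hne.symm, add_zero, zero_add]
        · rw [hS, add_mul, add_mul, hEE _ _ hne, hEE _ _ hne', zero_add, zero_add]
    have hEJ : ∀ k : Fin n, (k = ⟨0, hn⟩ ∨ k = i ∨ k = ⟨(i : ℕ) + 1, hi⟩) →
        ∀ y, E k * y ∈ closure (J : Set A) := fun k hk y =>
      mem_closure_of_mul_star_mem hJmul (by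
        rw [(hE k).isSelfAdjoint.star_eq]
        exact hEsq k hk) y
    have hEv : ∀ k, E k * v k = v k := by
      intro k
      have h := eq_zero_star_mul (x := v k) (b := 1 - E k) (by
        rw [mul_sub, mul_one, hvE, sub_self])
      rw [mul_sub, mul_one, sub_eq_zero] at h
      have h2 := congrArg star h
      rwa [star_star, star_mul, star_star, (hE k).isSelfAdjoint.star_eq, eq_comm] at h2
    have hvJ : ∀ k : Fin n, (k = ⟨0, hn⟩ ∨ k = i ∨ k = ⟨(i : ℕ) + 1, hi⟩) →
        ∀ y, v k * y ∈ closure (J : Set A) := by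
      intro k hk y
      rw [← hEv k, mul_assoc]
      exact hEJ k hk _
    have hvE' : ∀ l, l ≠ i → star (v l) * E i = 0 := fun l hl =>
      eq_zero_star_mul (by rw [← hvE l, mul_assoc, hEE l i hl, mul_zero])
    have h0J : (0 : A) ∈ closure (J : Set A) := subset_closure J.zero_mem
    rw [hwb]
    refine add_mem_closure (by simpa using hEJ i (by simp) 1)
      (sum_mem_closure fun l => sum_mem_closure fun k => ?_)
    induction l using Fin.cases with
    | zero =>
      induction k using Fin.cases with
      | zero =>
        have h1 := (hcomm (E i) (haE i)).1
        have h2 := (hcomm (E i) (haE i)).2 0 0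
        simp only [Fin.cons_zero, hu]
        have h3 := (h1.mul_left (h2.mul_left h1)).eq
        rw [mul_assoc, mul_assoc] at h3
        rw [h3]
        exact hEJ i (by simp) _
      | succ k =>
        by_cases hk : k = ⟨0, hn⟩
        · simp only [Fin.cons_succ]
          exact hvJ k (Or.inl hk) _
        · rw [hg _ _ (by simpa using hn.ne) (Fin.succ_ne_zero k)
            (by simpa [Fin.ext_iff] using hk), zero_mul, mul_zero]
          exact h0J
    | succ l =>
      by_cases hl : l = i
      · subst hl
        induction k using Fin.cases with
        | zero =>
          rw [hg _ _ (by simpa using hi.ne) (Fin.succ_ne_zero l).symm (by simp), zero_mul,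
            mul_zero]
          exact h0J
        | succ k =>
          by_cases hk : k = l ∨ k = ⟨(l : ℕ) + 1, hi⟩
          · simp only [Fin.cons_succ]
            exact hvJ k (Or.inr hk) _
          · rw [not_or] at hk
            rw [hg _ _ (by simpa using hi.ne) (by simpa using hk.1)
              (by simpa [Fin.ext_iff] using hk.2), zero_mul, mul_zero]
            exact h0J
      · simp only [Fin.cons_succ, hvE' l hl, mul_zero]
        exact h0J
  · intro D _ _ hvD d hd hda hdn
    let J : AddSubgroup A :=
      (Submodule.span ℂ {y : A | ∃ d' ∈ D, ∃ x : A, y = d' * x}).toAddSubgroup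
    change w * d ∈ closure (J : Set A)
    have hDJ : ∀ d ∈ D, ∀ x, d * x ∈ J := fun d hd x => Submodule.subset_span ⟨d, hd, x, rfl⟩
    have hJmul : ∀ x ∈ J, ∀ y, x * y ∈ J := by
      intro x hx y
      change x ∈ Submodule.span ℂ _ at hx
      induction hx using Submodule.span_induction with
      | mem x hx =>
        obtain ⟨d, hd, z, rfl⟩ := hx
        rw [mul_assoc]
        exact hDJ d hd _
      | zero => simp [J.zero_mem]
      | add x z _ _ h1 h2 => rw [add_mul]; exact J.add_mem h1 h2
      | smul t x _ h => rw [smul_mul_assoc]; exact Submodule.smul_mem _ t h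
    have hvJ : ∀ k y, v k * y ∈ closure (J : Set A) := fun k y =>
      mem_closure_of_mul_star_mem hJmul (by simpa using hDJ _ (hvD k) 1) y
    have h0J : (0 : A) ∈ closure (J : Set A) := subset_closure J.zero_mem
    rw [hwb]
    refine add_mem_closure (subset_closure (by simpa using hDJ d hd 1))
      (sum_mem_closure fun l => sum_mem_closure fun k => ?_)
    induction k using Fin.cases with
    | succ k => exact hvJ k _
    | zero =>
      induction l using Fin.cases with
      | zero =>
        have h1 := (hcomm d hda.symm).1
        have h2 := (hcomm d hda.symm).2 0 0
        simp only [Fin.cons_zero, hu]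
        have h3 := (h1.mul_left (h2.mul_left h1)).eq
        rw [mul_assoc, mul_assoc] at h3
        rw [h3]
        exact subset_closure (hDJ d hd _)
      | succ l =>
        by_cases hl : l = ⟨n - 1, Nat.sub_lt hn Nat.one_pos⟩
        · simp only [Fin.cons_succ, hl, hdn, mul_zero]
          exact h0J
        · have hl' : ((l.succ : Fin (n + 1)) : ℕ) ≠ n := by
            intro h
            refine hl (Fin.ext ?_)
            simp only [Fin.val_succ] at h
            simp only
            omega
          rw [hg _ _ hl' (Fin.succ_ne_zero l).symm (by simp), zero_mul, mul_zero]
          exact h0J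
  · intro c _ hc
    let J : AddSubgroup A := (AddMonoidHom.mulLeft (v ⟨0, hn⟩ * star (v ⟨0, hn⟩))).range
    change w * c ∈ closure (J : Set A)
    have hJmul : ∀ x ∈ J, ∀ y, x * y ∈ J := by
      rintro _ ⟨x, rfl⟩ y
      exact ⟨x * y, (mul_assoc _ _ _).symm⟩
    have hvJ : ∀ y, v ⟨0, hn⟩ * y ∈ closure (J : Set A) := fun y =>
      mem_closure_of_mul_star_mem hJmul ⟨1, mul_one _⟩ y
    have hvc : ∀ l, star (v l) * c = 0 := fun l => by rw [← hc, ← mul_assoc, hav, zero_mul]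
    have h0J : (0 : A) ∈ closure (J : Set A) := subset_closure J.zero_mem
    have h0 : c + u * (g 0 0 * (u * c)) = 0 := by
      have : c + u * (g 0 0 * (u * c)) = (1 + u * g 0 0 * u) * c := by noncomm_ring
      rw [this, hy, mul_assoc, sub_mul, one_mul, hc, sub_self, mul_zero]
    rw [hwb, Fin.sum_univ_succ, Fin.sum_univ_succ]
    simp only [Fin.cons_zero, Fin.cons_succ, hu, hvc, mul_zero, Finset.sum_const_zero, add_zero]
    rw [← add_assoc, h0, zero_add]
    refine sum_mem_closure fun k => ?_
    by_cases hk : k = ⟨0, hn⟩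
    · rw [hk]
      exact hvJ _
    · rw [hg _ _ (by simpa using hn.ne) (Fin.succ_ne_zero k)
        (by simpa [Fin.ext_iff] using hk), zero_mul, mul_zero]
      exact h0J
end

section
/- Let R be a ring, let e_1, ..., e_n ∈ R satisfy e_i e_j = 0 for all i ≠ j, and let x ∈ R satisfy x = (e_1 + ⋯ + e_n) x (e_1 + ⋯ + e_n) and e_i x e_j = 0 whenever j ≥ i. Then x^n = 0. -/
/-- If `x = (∑ j, e j) * x * (∑ j, e j)` for pairwise orthogonal `e j`, then
`x * e i` is a sum of left multiples of the products `e j * x * e i`. -/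
theorem mul_eq_sum_of_orthogonal {R ι : Type*} [NonUnitalRing R] [Fintype ι] (e : ι → R)
    (horth : ∀ i j : ι, i ≠ j → e i * e j = 0) {x : R}
    (hx : x = (∑ i, e i) * x * (∑ i, e i)) (i : ι) :
    x * e i = ∑ j, e j * x * e i * e i := by
  have h : (∑ j, e j) * e i = e i * e i := by
    rw [Finset.sum_mul]
    exact Fintype.sum_eq_single i fun j hj => horth j i hj
  calc x * e i = (∑ j, e j) * x * ((∑ j, e j) * e i) := by rw [← mul_assoc, ← hx]
    _ = ∑ j, e j * x * e i * e i := by rw [h, ← mul_assoc]; simp only [Finset.sum_mul]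

/-- Let `R` be an associative (not necessarily unital) ring, let
`e 0, …, e (n-1) ∈ R` satisfy `e i * e j = 0` for `i ≠ j`, and let `x ∈ R` satisfy
`x = (∑ i, e i) * x * (∑ i, e i)` and `e i * x * e j = 0` whenever `j ≥ i`.
Then `x ^ n = 0`; since `R` need not be unital, the `n`-fold product `x ^ n` is expressed
as `(· * x)` iterated `n - 1` times starting from `x`. -/
theorem stmt3 {R : Type*} [NonUnitalRing R] (n : ℕ) (e : Fin n → R)
    (horth : ∀ i j : Fin n, i ≠ j → e i * e j = 0)
    (x : R) (hx : x = (∑ i, e i) * x * (∑ i, e i))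
    (htri : ∀ i j : Fin n, i ≤ j → e i * x * e j = 0) :
    (fun y => y * x)^[n - 1] x = 0 := by
  rcases n with _ | n
  · simpa using hx
  have key : ∀ k : ℕ, ∀ i : Fin (n + 1), n ≤ i + k → (fun y => y * x)^[k] x * e i = 0 := by
    intro k
    induction k with
    | zero =>
      intro i hi
      rw [Function.iterate_zero_apply, mul_eq_sum_of_orthogonal e horth hx i]
      refine Finset.sum_eq_zero fun j _ => ?_
      rw [htri j i (Fin.le_def.mpr (by omega)), zero_mul]
    | succ k ih =>
      intro i hi
      rw [Function.iterate_succ_apply', mul_assoc, mul_eq_sum_of_orthogonal e horth hx i,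
        Finset.mul_sum]
      refine Finset.sum_eq_zero fun j _ => ?_
      rcases le_or_gt j i with h | h
      · rw [htri j i h, zero_mul, mul_zero]
      · rw [← mul_assoc, ← mul_assoc, ← mul_assoc, ih j (by have := Fin.lt_def.mp h; omega)]
        simp only [zero_mul]
  rw [Nat.add_sub_cancel]
  rcases n with _ | n
  · simpa [htri 0 0 le_rfl] using hx
  rw [Function.iterate_succ_apply']
  have hy : ∀ y : R, (∀ j : Fin (n + 2), 0 < (j : ℕ) → y * e j = 0) → y * x = 0 := by
    intro y hy
    rw [hx, Finset.mul_sum, Finset.mul_sum]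
    refine Finset.sum_eq_zero fun i _ => ?_
    rw [Finset.sum_mul, Finset.sum_mul, Finset.mul_sum]
    refine Finset.sum_eq_zero fun j _ => ?_
    rcases Nat.eq_zero_or_pos (j : ℕ) with h | h
    · rw [htri j i (Fin.le_def.mpr (by omega)), mul_zero]
    · rw [← mul_assoc, ← mul_assoc, hy j h, zero_mul, zero_mul]
  exact hy _ fun j hj => key n j (by omega)
end

section
/- Let A be a finite unital C*-algebra and let a ∈ A. Suppose there exist positive elements b_1, b_2, c_1, c_2 ∈ A such that: (1) b_1 + b_2 = 1; (2) c_1 + c_2 = 1; (3) b_1, b_2, c_1, c_2 pairwise commute; (4) b_1 c_1 = c_1; (5) b_2 c_2 = b_2; (6) c_1 b_2 = 0; (7) there are unitaries u, v ∈ A such that u(b_2 a (b_1 − c_1) + b_2 a b_2)v and u(b_2 a b_2)v are nilpotent, v (u (b_2 a b_2) v)^n u lies in the norm closure of {b_2 x b_2 : x ∈ A} for every n = 1, 2, ..., and c_1 v u b_2 = 0; (8) b_1 a = 0. Then a lies in the norm closure of the set of invertible elements of A. -/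
/-- If `q` is nilpotent and `w * w = q * w`, then `w` is nilpotent. -/
theorem isNilpotent_of_mul_self_eq_mul {R : Type*} [Semiring R] {q w : R}
    (hq : IsNilpotent q) (h : w * w = q * w) : IsNilpotent w := by
  obtain ⟨k, hk⟩ := hq
  have key : ∀ n : ℕ, w ^ (n + 1) = q ^ n * w := by
    intro n
    induction n with
    | zero => simp
    | succ n ih => rw [pow_succ, ih, mul_assoc, h, ← mul_assoc, pow_succ]
  exact ⟨k + 1, by rw [key, hk, zero_mul]⟩

/-- In a complex normed algebra, if `u * a * v` is nilpotent for some units `u` and `v`, then `a`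
is a limit of invertible elements. -/
theorem mem_closure_isUnit_of_isNilpotent_units_mul {A : Type*} [NormedRing A] [NormedAlgebra ℂ A]
    {a : A} (u v : Aˣ) (h : IsNilpotent (u * a * v)) : a ∈ closure {x : A | IsUnit x} := by
  have hunit : ∀ t : ℂ, t ≠ 0 → IsUnit (a + t • ((↑u⁻¹ : A) * ↑v⁻¹)) := by
    intro t ht
    have hw : IsUnit (u * a * v + algebraMap ℂ A t) :=
      h.isUnit_add_right_of_commute ((isUnit_iff_ne_zero.mpr ht).map (algebraMap ℂ A))
        (Algebra.commutes t _).symm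
    have heq : a + t • ((↑u⁻¹ : A) * ↑v⁻¹) =
        ↑u⁻¹ * (u * a * v + algebraMap ℂ A t) * ↑v⁻¹ := by
      simp [mul_add, add_mul, mul_assoc, Algebra.algebraMap_eq_smul_one]
    rw [heq]
    exact (u⁻¹.isUnit.mul hw).mul v⁻¹.isUnit
  have hcont : Continuous fun t : ℂ => a + t • ((↑u⁻¹ : A) * ↑v⁻¹) := by fun_prop
  have hlim : Filter.Tendsto (fun t : ℂ => a + t • ((↑u⁻¹ : A) * ↑v⁻¹))
      (nhdsWithin 0 {0}ᶜ) (nhds a) := by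
    simpa using (hcont.tendsto 0).mono_left nhdsWithin_le_nhds
  exact mem_closure_of_tendsto hlim
    (Filter.mem_of_superset self_mem_nhdsWithin fun t ht => hunit t ht)


/-- Lemma 4.2 of the paper.  Let `A` be a finite unital C*-algebra
(every isometry is a unitary) and `a ∈ A`.  Suppose there exist positive `b₁, b₂, c₁, c₂`
with `b₁ + b₂ = 1`, `c₁ + c₂ = 1`, pairwise commuting, `b₁ c₁ = c₁`, `b₂ c₂ = b₂`,
`c₁ b₂ = 0`, unitaries `u, v` such that `u (b₂ a (b₁ - c₁) + b₂ a b₂) v` and `u (b₂ a b₂) v`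
are nilpotent, `v (u (b₂ a b₂) v)^n u` lies in the closure of `{b₂ x b₂ : x ∈ A}` for all
`n ≥ 1`, and `c₁ v u b₂ = 0`, and finally `b₁ a = 0`.  Then `a` lies in the norm closure of
the invertible elements of `A`. -/
theorem stmt4 {A : Type*} [CStarAlgebra A] [PartialOrder A] [StarOrderedRing A]
    (hfin : ∀ x : A, star x * x = 1 → x * star x = 1)
    (a b₁ b₂ c₁ c₂ : A)
    (hb₁ : 0 ≤ b₁) (hb₂ : 0 ≤ b₂) (hc₁ : 0 ≤ c₁) (hc₂ : 0 ≤ c₂)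
    (h1 : b₁ + b₂ = 1) (h2 : c₁ + c₂ = 1)
    (h3 : b₁ * b₂ = b₂ * b₁ ∧ b₁ * c₁ = c₁ * b₁ ∧ b₁ * c₂ = c₂ * b₁ ∧
          b₂ * c₁ = c₁ * b₂ ∧ b₂ * c₂ = c₂ * b₂ ∧ c₁ * c₂ = c₂ * c₁)
    (h4 : b₁ * c₁ = c₁) (h5 : b₂ * c₂ = b₂) (h6 : c₁ * b₂ = 0)
    (h7 : ∃ u v : A, (star u * u = 1 ∧ u * star u = 1) ∧ (star v * v = 1 ∧ v * star v = 1) ∧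
      IsNilpotent (u * (b₂ * a * (b₁ - c₁) + b₂ * a * b₂) * v) ∧
      IsNilpotent (u * (b₂ * a * b₂) * v) ∧
      (∀ n : ℕ, 1 ≤ n →
        v * (u * (b₂ * a * b₂) * v) ^ n * u ∈ closure (Set.range fun x : A => b₂ * x * b₂)) ∧
      c₁ * v * u * b₂ = 0)
    (h8 : b₁ * a = 0) :
    a ∈ closure {x : A | IsUnit x} := by
  obtain ⟨u, v, ⟨hu, hu'⟩, ⟨hv, hv'⟩, hq, -, -, hcvub⟩ := h7
  have ha : b₂ * a = a := by
    rw [← zero_add (b₂ * a), ← h8, ← add_mul, h1, one_mul]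
  have hsplit : b₂ * a * (b₁ - c₁) + b₂ * a * b₂ = a - a * c₁ := by
    rw [ha, ← mul_add, sub_add_eq_add_sub, h1, mul_sub, mul_one]
  rw [hsplit] at hq
  have hzero : c₁ * v * u * a = 0 := by
    rw [← ha, ← mul_assoc, hcvub, zero_mul]
  refine mem_closure_isUnit_of_isNilpotent_units_mul ⟨u, star u, hu', hu⟩ ⟨v, star v, hv', hv⟩
    (isNilpotent_of_mul_self_eq_mul hq ?_)
  calc u * a * v * (u * a * v)
      = u * (a - a * c₁) * v * (u * a * v) + u * a * (c₁ * v * u * a) * v := by noncomm_ring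
    _ = u * (a - a * c₁) * v * (u * a * v) := by rw [hzero, mul_zero, zero_mul, add_zero]
end

section
/- Let A be a finite unital C*-algebra, and define ZD(A) = {a ∈ A : there exist nonzero positive elements d_1, d_2 ∈ A with d_1 a = 0 and a d_2 = 0}. If every element of ZD(A) lies in the norm closure of the set GL(A) of invertible elements of A, then GL(A) is dense in A, i.e., A equals the norm closure of GL(A). -/
/-- In a unital C*-algebra in which isometries are unitary, an element `a` with `a⋆a` invertible
is itself invertible. -/
theorem isUnit_of_isUnit_star_mul_self {A : Type*} [CStarAlgebra A] [PartialOrder A]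
    [StarOrderedRing A] (hfin : ∀ x : A, star x * x = 1 → x * star x = 1) {a : A}
    (ha : IsUnit (star a * a)) : IsUnit a := by
  have h0 : (0 : ℝ) ∉ spectrum ℝ (star a * a) := spectrum.zero_notMem ℝ ha
  have hpos : ∀ t ∈ spectrum ℝ (star a * a), 0 < t := fun t ht =>
    lt_of_le_of_ne (spectrum_nonneg_of_nonneg (star_mul_self_nonneg a) ht)
      fun h => h0 (h ▸ ht)
  have hc : ContinuousOn (fun t : ℝ => (Real.sqrt t)⁻¹) (spectrum ℝ (star a * a)) :=
    Real.continuous_sqrt.continuousOn.inv₀ fun t ht => (Real.sqrt_pos.2 (hpos t ht)).ne'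
  have hsa : IsSelfAdjoint (star a * a) := .star_mul_self a
  set c : A := cfc (fun t : ℝ => (Real.sqrt t)⁻¹) (star a * a)
  have hcs : star c = c := (cfc_predicate _ _ : IsSelfAdjoint c)
  have hiso : star (a * c) * (a * c) = 1 := by
    have h1 : c * (star a * a) * c = 1 := by
      calc c * (star a * a) * c
          = cfc (fun t : ℝ => (Real.sqrt t)⁻¹ * t * (Real.sqrt t)⁻¹) (star a * a) := by
            rw [cfc_mul (fun t : ℝ => (Real.sqrt t)⁻¹ * t) (fun t => (Real.sqrt t)⁻¹) _
              (hc.mul continuousOn_id) hc,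
              cfc_mul (fun t : ℝ => (Real.sqrt t)⁻¹) (fun t => t) _ hc continuousOn_id,
              cfc_id' ℝ (star a * a)]
        _ = cfc (fun _ : ℝ => (1 : ℝ)) (star a * a) := by
            refine cfc_congr fun t ht => ?_
            have hs := Real.sqrt_pos.2 (hpos t ht)
            have := Real.mul_self_sqrt (hpos t ht).le
            field_simp
            nlinarith
        _ = 1 := cfc_const_one ℝ _
    rw [star_mul, hcs]
    simpa only [mul_assoc] using h1
  have hright : a * (c * star (a * c)) = 1 := by
    rw [← mul_assoc]
    exact hfin _ hiso
  obtain ⟨u, hu⟩ := ha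
  have hleft : (↑u⁻¹ * star a) * a = 1 := by rw [mul_assoc, ← hu, Units.inv_mul]
  exact isUnit_iff_exists.2 ⟨_, hright, by rwa [← left_inv_eq_right_inv hleft hright]⟩

/-- If `a⋆a` is not invertible, then right multiplication by a suitable positive contraction moves
`a` arbitrarily little and makes it a right zero divisor. -/
theorem exists_cutoff {A : Type*} [CStarAlgebra A] [PartialOrder A]
    [StarOrderedRing A] {a : A} (ha : ¬ IsUnit (star a * a)) {ε : ℝ} (hε : 0 < ε) :
    ∃ e d : A, IsSelfAdjoint e ∧ ‖e‖ ≤ 1 ∧ d ≠ 0 ∧ 0 ≤ d ∧ e * d = 0 ∧ ‖a - a * e‖ ≤ ε := by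
  obtain ⟨δ, hδ, hδε⟩ : ∃ δ : ℝ, 0 < δ ∧ 2 * δ = ε ^ 2 := ⟨ε ^ 2 / 2, by positivity, by ring⟩
  set h : A := star a * a with hh
  have hsa : IsSelfAdjoint h := .star_mul_self a
  have hnn : ∀ t ∈ spectrum ℝ h, 0 ≤ t := fun t ht =>
    spectrum_nonneg_of_nonneg (star_mul_self_nonneg a) ht
  let f : ℝ → ℝ := fun t => min 1 (max 0 (t / δ - 1))
  let k : ℝ → ℝ := fun t => max 0 (1 - t / δ)
  have hf : Continuous f := by fun_prop
  have hk : Continuous k := by fun_prop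
  have hf0 : ∀ t, 0 ≤ f t := fun t => le_min zero_le_one (le_max_left _ _)
  have hf1 : ∀ t, f t ≤ 1 := fun t => min_le_left _ _
  refine ⟨cfc f h, cfc k h, cfc_predicate _ _, ?_, ?_, ?_, ?_, ?_⟩
  · refine norm_cfc_le zero_le_one fun t _ => ?_
    rw [Real.norm_of_nonneg (hf0 t)]
    exact hf1 t
  · intro hd
    have h0 : (0 : ℝ) ∈ spectrum ℝ h := by
      rw [spectrum.zero_mem_iff]
      exact ha
    have h1 : k 0 ∈ spectrum ℝ (cfc k h) := by
      rw [cfc_map_spectrum k h]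
      exact ⟨0, h0, rfl⟩
    have : Nontrivial A := ⟨⟨h, 1, fun e => ha (e ▸ isUnit_one)⟩⟩
    rw [hd, spectrum.zero_eq] at h1
    simp [k] at h1
  · exact cfc_nonneg fun t _ => le_max_left _ _
  · rw [← cfc_mul f k h hf.continuousOn hk.continuousOn]
    have : (fun t => f t * k t) = fun _ => (0 : ℝ) := by
      funext t
      rcases le_total (t / δ) 1 with ht | ht
      · have : f t = 0 := by
          simp only [f]
          rw [max_eq_left (by linarith), min_eq_right zero_le_one]
        rw [this, zero_mul]
      · have : k t = 0 := max_eq_left (by linarith)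
        rw [this, mul_zero]
    rw [this, cfc_const_zero]
  · have hg : Continuous fun t => 1 - f t := continuous_const.sub hf
    set g : A := cfc (fun t => 1 - f t) h with hgdef
    have hgs : star g = g := (cfc_predicate _ _ : IsSelfAdjoint g)
    have hag : a - a * cfc f h = a * g := by
      rw [hgdef, cfc_sub (fun _ => (1 : ℝ)) f h continuousOn_const hf.continuousOn,
        cfc_const_one ℝ h, mul_sub, mul_one]
    have hprod : star (a * g) * (a * g) = cfc (fun t => (1 - f t) * t * (1 - f t)) h := by
      rw [cfc_mul (fun t => (1 - f t) * t) (fun t => 1 - f t) h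
          (hg.mul continuous_id).continuousOn hg.continuousOn,
        cfc_mul (fun t => 1 - f t) (fun t => t) h hg.continuousOn continuousOn_id, cfc_id' ℝ h, ← hgdef, star_mul, hgs, hh]
      simp only [mul_assoc]
    have hnorm : ‖a * g‖ * ‖a * g‖ ≤ ε ^ 2 := by
      rw [← CStarRing.norm_star_mul_self, hprod]
      refine norm_cfc_le (sq_nonneg ε) fun t ht => ?_
      have ht0 := hnn t ht
      have h1 : 0 ≤ 1 - f t := sub_nonneg.2 (hf1 t)
      have h2 : 1 - f t ≤ 1 := by linarith [hf0 t]
      rw [Real.norm_of_nonneg (by positivity)]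
      rcases le_total t (2 * δ) with hle | hle
      · calc (1 - f t) * t * (1 - f t) ≤ 1 * t * 1 := by gcongr
          _ ≤ ε ^ 2 := by linarith
      · have h3 : 2 ≤ t / δ := (le_div_iff₀ hδ).2 hle
        have : f t = 1 := min_eq_left (le_max_of_le_right (by linarith))
        rw [this]
        nlinarith
    rw [hag]
    exact abs_le_of_sq_le_sq' (by nlinarith) hε.le |>.2


/-- Let `A` be a finite unital C*-algebra (every isometry is a unitary) and
let `ZD(A)` be the set of `a ∈ A` admitting nonzero positive `d₁, d₂` with `d₁ a = 0` and
`a d₂ = 0`.  If every element of `ZD(A)` lies in the norm closure of the invertible elements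
`GL(A)`, then `GL(A)` is dense in `A`. -/
theorem stmt5 {A : Type*} [CStarAlgebra A] [PartialOrder A] [StarOrderedRing A]
    (hfin : ∀ x : A, star x * x = 1 → x * star x = 1)
    (hZD : ∀ a : A,
      (∃ d₁ d₂ : A, d₁ ≠ 0 ∧ d₂ ≠ 0 ∧ 0 ≤ d₁ ∧ 0 ≤ d₂ ∧ d₁ * a = 0 ∧ a * d₂ = 0) →
      a ∈ closure {x : A | IsUnit x}) :
    closure {x : A | IsUnit x} = Set.univ := by
  refine Set.eq_univ_of_forall fun a => ?_
  by_cases h1 : IsUnit (star a * a)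
  · exact subset_closure (isUnit_of_isUnit_star_mul_self hfin h1)
  by_cases h2 : IsUnit (star (star a) * star a)
  · exact subset_closure (isUnit_star.1 (isUnit_of_isUnit_star_mul_self hfin h2))
  rw [← closure_closure, Metric.mem_closure_iff]
  intro ε hε
  obtain ⟨e, d, -, he1, hd, hd0, hed, hae⟩ := exists_cutoff h1 (ε := ε / 3) (by positivity)
  obtain ⟨e', d', hes', he1', hd', hd0', hed', hae'⟩ :=
    exists_cutoff h2 (ε := ε / 3) (by positivity)
  have hde : d' * e' = 0 := by
    simpa [hes'.star_eq, (IsSelfAdjoint.of_nonneg hd0').star_eq] using congrArg star hed'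
  have hae'' : ‖a - e' * a‖ ≤ ε / 3 := by
    rw [← norm_star]
    simpa [hes'.star_eq] using hae'
  refine ⟨e' * a * e, hZD _ ⟨d', d, hd', hd, hd0', hd0, ?_, ?_⟩, ?_⟩
  · rw [← mul_assoc, ← mul_assoc, hde, zero_mul, zero_mul]
  · rw [mul_assoc, hed, mul_zero]
  · rw [dist_eq_norm]
    calc ‖a - e' * a * e‖ = ‖(a - e' * a) + e' * (a - a * e)‖ := by
          congr 1
          noncomm_ring
      _ ≤ ‖a - e' * a‖ + ‖e'‖ * ‖a - a * e‖ :=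
          (norm_add_le _ _).trans (by gcongr; exact norm_mul_le _ _)
      _ ≤ ε / 3 + 1 * (ε / 3) := by gcongr
      _ < ε := by linarith
end

section
/- Let Γ be an infinite group satisfying the Følner condition, and let Γ_1, Γ_2, ..., Γ_T ⊆ Γ be finite subsets, each containing the identity, which tile Γ. Let δ ∈ (0,1] and let n be a positive integer. Then there exist a finite set 𝓕 ⊆ Γ and ε > 0 such that for every nonempty finite (𝓕, ε)-invariant set F ⊆ Γ, there is a subset H ⊆ F such that H is tiled by Γ_1, ..., Γ_T with multiplicities divisible by n and |H| > (1 − δ)|F|. -/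
open Pointwise

/-- A finite subset `F` of a group is `(K, ε)`-invariant if `|FK △ F| < ε |F|`. -/
def IsInvariantSet {Γ : Type*} [Group Γ] [DecidableEq Γ] (K : Finset Γ) (ε : ℝ)
    (F : Finset Γ) : Prop :=
  ((symmDiff (F * K) F).card : ℝ) < ε * F.card

/-- A group `Γ` satisfies the Følner condition if for every finite `K ⊆ Γ` and every `ε > 0`
there is a nonempty finite `(K, ε)`-invariant subset of `Γ`. -/
def FolnerCondition (Γ : Type*) [Group Γ] [DecidableEq Γ] : Prop :=
  ∀ K : Finset Γ, ∀ ε : ℝ, 0 < ε → ∃ F : Finset Γ, F.Nonempty ∧ IsInvariantSet K ε F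

/-- The finite sets `S 0, …, S (T-1)` tile the group `Γ`: there are center sets
`C 0, …, C (T-1) ⊆ Γ` such that the left translates `c • S t` (`c ∈ C t`) are pairwise
disjoint and cover `Γ`. -/
def TilesGroup {Γ : Type*} [Group Γ] {T : ℕ} (S : Fin T → Finset Γ) : Prop :=
  ∃ C : Fin T → Set Γ,
    (∀ (t₁ t₂ : Fin T) (c₁ c₂ : Γ), c₁ ∈ C t₁ → c₂ ∈ C t₂ → (t₁, c₁) ≠ (t₂, c₂) →
      Disjoint (c₁ • (S t₁ : Set Γ)) (c₂ • (S t₂ : Set Γ))) ∧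
    (⋃ t : Fin T, ⋃ c ∈ C t, c • (S t : Set Γ)) = Set.univ

/-- A finite set `H ⊆ Γ` is tiled by `S 0, …, S (T-1)` with multiplicities divisible by `n`:
`H` is a disjoint union of left translates of the sets `S t` in which, for each `t`, the
number of translates of `S t` used is divisible by `n`. -/
def TiledWithMultiplicities {Γ : Type*} [Group Γ] [DecidableEq Γ] {T : ℕ}
    (S : Fin T → Finset Γ) (n : ℕ) (H : Finset Γ) : Prop :=
  ∃ D : Fin T → Finset Γ,
    (∀ (t₁ t₂ : Fin T) (c₁ c₂ : Γ), c₁ ∈ D t₁ → c₂ ∈ D t₂ → (t₁, c₁) ≠ (t₂, c₂) →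
      Disjoint (c₁ • S t₁) (c₂ • S t₂)) ∧
    Finset.univ.biUnion (fun t : Fin T => (D t).biUnion fun c => c • S t) = H ∧
    ∀ t, n ∣ (D t).card

open Finset in
/-- The points of `F` that some element of `K` moves out of `F` number at most
`|K| * |(F * L) \ F|`, for any `L ⊇ K`. -/
theorem card_filter_exists_mul_notMem_le {Γ : Type*} [Group Γ] [DecidableEq Γ]
    (F : Finset Γ) {K L : Finset Γ} (hKL : K ⊆ L) :
    #{x ∈ F | ∃ k ∈ K, x * k ∉ F} ≤ #K * #((F * L) \ F) := by
  have hsub : {x ∈ F | ∃ k ∈ K, x * k ∉ F} ⊆ K.biUnion fun k => {x ∈ F | x * k ∉ F} := by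
    intro x hx
    obtain ⟨hxF, k, hk, hxk⟩ := mem_filter.1 hx
    exact mem_biUnion.2 ⟨k, hk, mem_filter.2 ⟨hxF, hxk⟩⟩
  refine (card_le_card hsub).trans (card_biUnion_le_card_mul _ _ _ fun k hk => ?_)
  refine card_le_card_of_injOn (· * k) (fun x hx => ?_) (mul_left_injective k).injOn
  obtain ⟨hxF, hxk⟩ := mem_filter.1 hx
  exact mem_sdiff.2 ⟨mul_mem_mul hxF (hKL hk), hxk⟩

open Finset in
/-- A nonempty `(K, ε)`-invariant set is large when `K` is large. -/
theorem IsInvariantSet.card_lt {Γ : Type*} [Group Γ] [DecidableEq Γ] {K F : Finset Γ} {ε : ℝ}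
    (hF : F.Nonempty) (h : IsInvariantSet K ε F) : (#K : ℝ) < (1 + ε) * #F := by
  have h₁ : #K ≤ #(F * K) := card_le_card_mul_left hF
  have h₂ : #(F * K) ≤ #(symmDiff (F * K) F) + #F := by
    refine (card_le_card fun x hx => ?_).trans (card_union_le _ _)
    by_cases hxF : x ∈ F <;> simp [mem_symmDiff, hx, hxF]
  have h₃ : (#K : ℝ) ≤ #(symmDiff (F * K) F) + #F := by exact_mod_cast h₁.trans h₂
  unfold IsInvariantSet at h
  linarith

open Finset in
/-- If `S` tiles the group, every finite `F` contains a set tiled by `S` with multiplicities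
divisible by `n` that misses at most `n` tiles of each shape and the points close to the
boundary of `F`. -/
theorem TilesGroup.exists_tiledWithMultiplicities {Γ : Type*} [Group Γ] [DecidableEq Γ] {T : ℕ}
    {S : Fin T → Finset Γ} (htile : TilesGroup S) (hid : ∀ t, (1 : Γ) ∈ S t) {n : ℕ}
    (hn : 0 < n) (F : Finset Γ) :
    ∃ H ⊆ F, TiledWithMultiplicities S n H ∧
      #F ≤ #H + #{x ∈ F | ∃ k ∈ univ.biUnion fun t => (S t)⁻¹ * S t, x * k ∉ F} +
        ∑ t, n * #(S t) := by
  classical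
  obtain ⟨C, hdisj, hcover⟩ := htile
  let G : Fin T → Finset Γ := fun t => {c ∈ F | c ∈ C t ∧ c • S t ⊆ F}
  have hD (t : Fin T) : ∃ D ⊆ G t, #D = n * (#(G t) / n) :=
    exists_subset_card_eq (Nat.mul_div_le _ _)
  choose D hDG hDcard using hD
  set H := univ.biUnion fun t : Fin T => (D t).biUnion fun c => c • S t
  refine ⟨H, ?_, ⟨D, ?_, rfl, fun t => ⟨_, hDcard t⟩⟩, ?_⟩
  · refine biUnion_subset.2 fun t _ => biUnion_subset.2 fun c hc => ?_
    exact (mem_filter.1 (hDG t hc)).2.2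
  · intro t₁ t₂ c₁ c₂ h₁ h₂ hne
    have := hdisj t₁ t₂ c₁ c₂ (mem_filter.1 (hDG t₁ h₁)).2.1 (mem_filter.1 (hDG t₂ h₂)).2.1 hne
    rw [← disjoint_coe]
    simpa using this
  set B := {x ∈ F | ∃ k ∈ univ.biUnion fun t => (S t)⁻¹ * S t, x * k ∉ F}
  set R := univ.biUnion fun t : Fin T => (G t \ D t).biUnion fun c => c • S t
  have hR : #R ≤ ∑ t, n * #(S t) := by
    refine card_biUnion_le.trans (sum_le_sum fun t _ => ?_)
    refine (card_biUnion_le_card_mul _ _ _ fun c _ => (card_smul_finset c (S t)).le).trans ?_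
    refine Nat.mul_le_mul_right _ ?_
    rw [card_sdiff_of_subset (hDG t), hDcard t]
    have := Nat.div_add_mod #(G t) n
    have := Nat.mod_lt #(G t) hn
    omega
  have hsub : F ⊆ H ∪ B ∪ R := by
    intro x hx
    have hxu : x ∈ ⋃ t : Fin T, ⋃ c ∈ C t, c • (S t : Set Γ) := hcover ▸ Set.mem_univ x
    simp only [Set.mem_iUnion] at hxu
    obtain ⟨t, c, hc, s, hs, rfl⟩ := hxu
    have hs : s ∈ S t := hs
    simp only [smul_eq_mul] at hx ⊢
    have hmem : c * s ∈ c • S t := smul_mem_smul_finset hs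
    by_cases hcF : c • S t ⊆ F
    · have hcG : c ∈ G t := by
        refine mem_filter.2 ⟨hcF ?_, hc, hcF⟩
        simpa using smul_mem_smul_finset (a := c) (hid t)
      by_cases hcD : c ∈ D t
      · exact mem_union_left _ <| mem_union_left _ <|
          mem_biUnion.2 ⟨t, mem_univ t, mem_biUnion.2 ⟨c, hcD, hmem⟩⟩
      · exact mem_union_right _ <|
          mem_biUnion.2 ⟨t, mem_univ t, mem_biUnion.2 ⟨c, mem_sdiff.2 ⟨hcG, hcD⟩, hmem⟩⟩
    · obtain ⟨y, hy, hyF⟩ := not_subset.1 hcF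
      obtain ⟨s', hs', rfl⟩ := mem_smul_finset.1 hy
      refine mem_union_left _ <| mem_union_right _ <| mem_filter.2 ⟨hx, s⁻¹ * s',
        mem_biUnion.2 ⟨t, mem_univ t, mul_mem_mul (inv_mem_inv hs) hs'⟩, ?_⟩
      simpa [mul_assoc] using hyF
  have h₁ := card_le_card hsub
  have h₂ := card_union_le (H ∪ B) R
  have h₃ := card_union_le H B
  omega

/-- Lemma 6.1 of the paper.  Let `Γ` be an infinite group satisfying the
Følner condition, and let `S 0, …, S (T-1)` be finite subsets of `Γ`, each containing the
identity, which tile `Γ`.  Let `δ ∈ (0,1]` and `n ≥ 1`.  Then there are a finite set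
`𝓕 ⊆ Γ` and `ε > 0` such that every nonempty finite `(𝓕, ε)`-invariant `F ⊆ Γ` contains
a subset `H` tiled by `S 0, …, S (T-1)` with multiplicities divisible by `n` and with
`|H| > (1 - δ)|F|`. -/
theorem stmt8 {Γ : Type*} [Group Γ] [DecidableEq Γ] [Infinite Γ]
    (hΓ : FolnerCondition Γ)
    (T : ℕ) (S : Fin T → Finset Γ) (hid : ∀ t, (1 : Γ) ∈ S t) (htile : TilesGroup S)
    (δ : ℝ) (hδ0 : 0 < δ) (hδ1 : δ ≤ 1) (n : ℕ) (hn : 0 < n) :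
    ∃ (𝓕 : Finset Γ) (ε : ℝ), 0 < ε ∧
      ∀ F : Finset Γ, F.Nonempty → IsInvariantSet 𝓕 ε F →
        ∃ H : Finset Γ, H ⊆ F ∧ TiledWithMultiplicities S n H ∧
          (1 - δ) * (F.card : ℝ) < (H.card : ℝ) := by
  classical
  set K : Finset Γ := Finset.univ.biUnion fun t => (S t)⁻¹ * S t
  set M : ℕ := ∑ t, n * (S t).card
  obtain ⟨A, hA⟩ := Infinite.exists_subset_card_eq Γ ⌈4 * M / δ⌉₊
  have hε : 0 < δ / (2 * (K.card + 1)) := by positivity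
  refine ⟨K ∪ A, δ / (2 * (K.card + 1)), hε, fun F hF hinv => ?_⟩
  obtain ⟨H, hHF, hHt, hcard⟩ := htile.exists_tiledWithMultiplicities hid hn F
  refine ⟨H, hHF, hHt, ?_⟩
  have hFpos : (0 : ℝ) < F.card := by exact_mod_cast hF.card_pos
  have hbig : (M : ℝ) < δ / 2 * F.card := by
    have h₁ : 4 * M / δ ≤ ((K ∪ A).card : ℝ) := by
      refine (Nat.le_ceil _).trans ?_
      exact_mod_cast hA ▸ Finset.card_le_card Finset.subset_union_right
    have h₂ := hinv.card_lt hF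
    have h₃ : δ / (2 * (K.card + 1)) ≤ 1 := by
      rw [div_le_one (by positivity)]
      linarith [Nat.cast_nonneg (α := ℝ) K.card]
    have h₄ : 4 * M / δ < 2 * F.card := by nlinarith
    rw [div_lt_iff₀ hδ0] at h₄
    linarith
  have hbad := card_filter_exists_mul_notMem_le F (Finset.subset_union_left (s₁ := K) (s₂ := A))
  have hsd : (((F * (K ∪ A)) \ F).card : ℝ) ≤ δ / (2 * (K.card + 1)) * F.card := by
    refine le_trans ?_ hinv.le
    exact_mod_cast Finset.card_le_card Finset.subset_union_left
  have hKε : K.card * (δ / (2 * (K.card + 1))) ≤ δ / 2 := by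
    rw [← mul_div_assoc, div_le_div_iff₀ (by positivity) two_pos]
    nlinarith
  have hbad' : ((F.filter fun x => ∃ k ∈ K, x * k ∉ F).card : ℝ) ≤ δ / 2 * F.card :=
    calc _ ≤ (K.card : ℝ) * ((F * (K ∪ A)) \ F).card := by exact_mod_cast hbad
      _ ≤ K.card * (δ / (2 * (K.card + 1)) * F.card) := by gcongr
      _ = K.card * (δ / (2 * (K.card + 1))) * F.card := by ring
      _ ≤ δ / 2 * F.card := by gcongr
  have hcard' : (F.card : ℝ) ≤
      H.card + (F.filter fun x => ∃ k ∈ K, x * k ∉ F).card + M := by exact_mod_cast hcard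
  linarith
end

section
/- Let X be a compact metrizable space and let T be a compact set of Borel probability measures on X, where the space of Borel probability measures carries the topology of weak convergence. Let O ⊆ X be an open set and let λ, δ > 0 satisfy λ·μ(O) > δ for every μ ∈ T. Then there exists a closed set D ⊆ O such that λ·μ(D) > δ for every μ ∈ T. -/
open MeasureTheory

theorem MeasureTheory.ProbabilityMeasure.lt_mul_coe_iff_ofReal_div_lt {X : Type*}
    [MeasurableSpace X] (μ : ProbabilityMeasure X) (s : Set X) {a c : ℝ} (hc : 0 < c)
    (ha : 0 ≤ a) :
    a < c * (μ s : ℝ) ↔ ENNReal.ofReal (a / c) < (μ : Measure X) s := by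
  rw [← ProbabilityMeasure.ennreal_coeFn_eq_coeFn_toMeasure, ← ENNReal.ofReal_coe_nnreal,
    ENNReal.ofReal_lt_ofReal_iff_of_nonneg (by positivity), div_lt_iff₀' hc]

/-- Mass strictly above `r` in an open set persists on a closed subset, uniformly over a
neighborhood of the measure. -/
theorem MeasureTheory.ProbabilityMeasure.exists_isClosed_subset_eventually_lt {X : Type*}
    [TopologicalSpace X] [TopologicalSpace.PseudoMetrizableSpace X] [MeasurableSpace X]
    [BorelSpace X] {O : Set X} (hO : IsOpen O) {r : ENNReal} {μ : ProbabilityMeasure X}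
    (hr : r < (μ : Measure X) O) :
    ∃ D : Set X, IsClosed D ∧ D ⊆ O ∧
      ∀ᶠ ν : ProbabilityMeasure X in nhds μ, r < (ν : Measure X) D := by
  let _ := TopologicalSpace.pseudoMetrizableSpacePseudoMetric X
  obtain ⟨F, hFO, hF, hrF⟩ := hO.exists_lt_isClosed hr
  obtain ⟨U, hU, hFU, hUO⟩ := normal_exists_closure_subset hF hO hFO
  refine ⟨closure U, isClosed_closure, hUO, ?_⟩
  have hlim : r < (nhds μ).liminf fun ν : ProbabilityMeasure X ↦ (ν : Measure X) U :=
    (hrF.trans_le (measure_mono hFU)).trans_le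
      (ProbabilityMeasure.le_liminf_measure_open_of_tendsto Filter.tendsto_id hU)
  filter_upwards [Filter.eventually_lt_of_lt_liminf hlim] with ν hν
  exact hν.trans_le (measure_mono subset_closure)

/-- Lemma 7.5(1) of the paper.  Let `X` be a compact metrizable space and
`T` a compact set of Borel probability measures on `X` (with the topology of weak
convergence).  If `O ⊆ X` is open and `λ, δ > 0` satisfy `λ μ(O) > δ` for every `μ ∈ T`,
then there is a closed `D ⊆ O` with `λ μ(D) > δ` for every `μ ∈ T`. -/
theorem stmt10 {X : Type*} [TopologicalSpace X] [CompactSpace X]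
    [TopologicalSpace.MetrizableSpace X] [MeasurableSpace X] [BorelSpace X]
    (T : Set (ProbabilityMeasure X)) (hT : IsCompact T)
    (O : Set X) (hO : IsOpen O) (lam δ : ℝ) (hlam : 0 < lam) (hδ : 0 < δ)
    (h : ∀ μ ∈ T, δ < lam * (μ O : ℝ)) :
    ∃ D : Set X, IsClosed D ∧ D ⊆ O ∧ ∀ μ ∈ T, δ < lam * (μ D : ℝ) := by
  simp only [ProbabilityMeasure.lt_mul_coe_iff_ofReal_div_lt _ _ hlam hδ.le] at h ⊢
  refine hT.induction_on (p := fun S ↦ ∃ D : Set X, IsClosed D ∧ D ⊆ O ∧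
      ∀ μ ∈ S, ENNReal.ofReal (δ / lam) < (μ : Measure X) D) ?_ ?_ ?_ ?_
  · exact ⟨∅, isClosed_empty, Set.empty_subset O, by simp⟩
  · rintro S S' hS ⟨D, hD, hDO, hlt⟩
    exact ⟨D, hD, hDO, fun μ hμ ↦ hlt μ (hS hμ)⟩
  · rintro S S' ⟨D, hD, hDO, hlt⟩ ⟨D', hD', hDO', hlt'⟩
    refine ⟨D ∪ D', hD.union hD', Set.union_subset hDO hDO', ?_⟩
    rintro μ (hμ | hμ)
    · exact (hlt μ hμ).trans_le (measure_mono Set.subset_union_left)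
    · exact (hlt' μ hμ).trans_le (measure_mono Set.subset_union_right)
  · intro μ hμ
    obtain ⟨D, hD, hDO, hev⟩ :=
      ProbabilityMeasure.exists_isClosed_subset_eventually_lt hO (h μ hμ)
    exact ⟨_, mem_nhdsWithin_of_mem_nhds hev, D, hD, hDO, fun ν hν ↦ hν⟩
end

section
/- Let X be a compact metrizable space and let T be a compact set of Borel probability measures on X, where the space of Borel probability measures carries the topology of weak convergence. Let O ⊆ X be an open set, C ⊆ X a closed set, and λ > 0 such that λ·μ(O) > μ(C) for every μ ∈ T. Then there exist a closed set D ⊆ O and an open set F ⊇ C such that λ·μ(D) > μ(F) for every μ ∈ T. -/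
open MeasureTheory

open Filter Topology in
theorem eventually_measure_lt_of_isClosed {X : Type*} [TopologicalSpace X] [MeasurableSpace X]
    [OpensMeasurableSpace X] [HasOuterApproxClosed X] {μ : ProbabilityMeasure X} {K : Set X}
    (hK : IsClosed K) {a : NNReal} (h : μ K < a) : ∀ᶠ ν in 𝓝 μ, ν K < a := by
  have h' : (μ : Measure X) K < a := by
    rw [← ProbabilityMeasure.ennreal_coeFn_eq_coeFn_toMeasure]; exact_mod_cast h
  have := eventually_lt_of_limsup_lt
    ((ProbabilityMeasure.limsup_measure_closed_le_of_tendsto tendsto_id hK).trans_lt h')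
  filter_upwards [this] with ν hν
  simp only [id, ← ProbabilityMeasure.ennreal_coeFn_eq_coeFn_toMeasure] at hν
  exact_mod_cast hν

open Filter Topology in
theorem eventually_lt_measure_of_isOpen {X : Type*} [TopologicalSpace X] [MeasurableSpace X]
    [OpensMeasurableSpace X] [HasOuterApproxClosed X] {μ : ProbabilityMeasure X} {U : Set X}
    (hU : IsOpen U) {b : NNReal} (h : b < μ U) : ∀ᶠ ν in 𝓝 μ, b < ν U := by
  have h' : b < (μ : Measure X) U := by
    rw [← ProbabilityMeasure.ennreal_coeFn_eq_coeFn_toMeasure]; exact_mod_cast h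
  have := eventually_lt_of_lt_liminf
    (h'.trans_le (ProbabilityMeasure.le_liminf_measure_open_of_tendsto tendsto_id hU))
  filter_upwards [this] with ν hν
  simp only [id, ← ProbabilityMeasure.ennreal_coeFn_eq_coeFn_toMeasure] at hν
  exact_mod_cast hν

/-- Lemma 7.5(2) of the paper.  Let `X` be a compact metrizable space and
`T` a compact set of Borel probability measures on `X` (with the topology of weak
convergence).  If `O ⊆ X` is open, `C ⊆ X` is closed, and `λ > 0` satisfies
`λ μ(O) > μ(C)` for every `μ ∈ T`, then there are a closed `D ⊆ O` and an open `F ⊇ C`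
with `λ μ(D) > μ(F)` for every `μ ∈ T`. -/
theorem stmt11 {X : Type*} [TopologicalSpace X] [CompactSpace X]
    [TopologicalSpace.MetrizableSpace X] [MeasurableSpace X] [BorelSpace X]
    (T : Set (ProbabilityMeasure X)) (hT : IsCompact T)
    (O : Set X) (hO : IsOpen O) (C : Set X) (hC : IsClosed C)
    (lam : ℝ) (hlam : 0 < lam)
    (h : ∀ μ ∈ T, (μ C : ℝ) < lam * (μ O : ℝ)) :
    ∃ (D F : Set X), IsClosed D ∧ D ⊆ O ∧ IsOpen F ∧ C ⊆ F ∧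
      ∀ μ ∈ T, (μ F : ℝ) < lam * (μ D : ℝ) := by
  let _ := TopologicalSpace.metrizableSpaceMetric X
  lift lam to NNReal using hlam.le
  norm_cast at hlam h ⊢
  refine hT.induction_on (p := fun S ↦ ∃ (D F : Set X), IsClosed D ∧ D ⊆ O ∧ IsOpen F ∧ C ⊆ F ∧
      ∀ μ ∈ S, μ F < lam * μ D) ?_ ?_ ?_ ?_
  · exact ⟨∅, Set.univ, isClosed_empty, Set.empty_subset _, isOpen_univ, Set.subset_univ _,
      by simp⟩
  · rintro S S' hS ⟨D, F, hD, hDO, hF, hCF, hlt⟩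
    exact ⟨D, F, hD, hDO, hF, hCF, fun μ hμ ↦ hlt μ (hS hμ)⟩
  · rintro S S' ⟨D, F, hD, hDO, hF, hCF, hlt⟩ ⟨D', F', hD', hDO', hF', hCF', hlt'⟩
    refine ⟨D ∪ D', F ∩ F', hD.union hD', Set.union_subset hDO hDO', hF.inter hF',
      Set.subset_inter hCF hCF', ?_⟩
    rintro μ (hμ | hμ)
    · calc μ (F ∩ F') ≤ μ F := μ.apply_mono Set.inter_subset_left
        _ < lam * μ D := hlt μ hμ
        _ ≤ lam * μ (D ∪ D') := by gcongr; exact Set.subset_union_left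
    · calc μ (F ∩ F') ≤ μ F' := μ.apply_mono Set.inter_subset_right
        _ < lam * μ D' := hlt' μ hμ
        _ ≤ lam * μ (D ∪ D') := by gcongr; exact Set.subset_union_right
  · intro μ hμ
    obtain ⟨b, hCb, hbO⟩ := exists_between ((div_lt_iff₀' hlam).2 (h μ hμ))
    rw [div_lt_iff₀' hlam] at hCb
    have hCb' : (μ : Measure X) C < ((lam * b : NNReal) : ENNReal) := by
      rw [← ProbabilityMeasure.ennreal_coeFn_eq_coeFn_toMeasure]; exact_mod_cast hCb
    have hbO' : (b : ENNReal) < (μ : Measure X) O := by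
      rw [← ProbabilityMeasure.ennreal_coeFn_eq_coeFn_toMeasure]; exact_mod_cast hbO
    obtain ⟨U, hCU, hU, hUb⟩ := C.exists_isOpen_lt_of_lt _ hCb'
    obtain ⟨K, hKO, hK, hbK⟩ := hO.exists_lt_isClosed hbO'
    obtain ⟨F, hF, hCF, hFU⟩ := normal_exists_closure_subset hC hU hCU
    obtain ⟨V, hV, hKV, hVO⟩ := normal_exists_closure_subset hK hO hKO
    rw [← ProbabilityMeasure.ennreal_coeFn_eq_coeFn_toMeasure] at hUb hbK
    norm_cast at hUb hbK
    have hF_ev := eventually_measure_lt_of_isClosed isClosed_closure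
      ((μ.apply_mono hFU).trans_lt hUb)
    have hV_ev := eventually_lt_measure_of_isOpen hV (hbK.trans_le (μ.apply_mono hKV))
    refine ⟨_, mem_nhdsWithin_of_mem_nhds (hF_ev.and hV_ev), closure V, F, isClosed_closure,
      hVO, hF, hCF, ?_⟩
    rintro ν ⟨hνF, hνV⟩
    calc ν F ≤ ν (closure F) := ν.apply_mono subset_closure
      _ < lam * b := hνF
      _ ≤ lam * ν (closure V) := by
        gcongr; exact hνV.le.trans (ν.apply_mono subset_closure)
end
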